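/- arXiv:2312.09664 — 7 statements merged into one kernel-verified Lean document; each statement's English description precedes it below -/
import Mathlib

section
/- Let R > 0 and let a : ℕ → ℍ be a sequence of quaternions such that the series f(q) = Σ_{m≥0} qᵐ aₘ converges for every quaternion q with |q| < R. Let I ∈ ℍ satisfy I² = −1 and let ℂ_I = {x + y·I : x, y ∈ ℝ}. Then f maps {q ∈ ℍ : |q| < R} ∩ ℂ_I into ℂ_I if and only if aₘ ∈ ℂ_I for every m ≥ 0. -/
noncomputable section

abbrev H : Type := Quaternion ℝ

namespace QPaper

/-- The complex slice determined by `I`: the real span of `1` and `I`. -/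
def sliceSet (I : H) : Set H := {q | ∃ x y : ℝ, q = (x : H) + y • I}

/-- Evaluation of the power series `q ↦ ∑ qᵐ aₘ` with right coefficients. -/
def evalC (a : ℕ → H) (q : H) : H := ∑' m, q ^ m * a m

/-- The series with coefficients `a` converges at every point of the unit ball. -/
def SummableOn (a : ℕ → H) : Prop := ∀ q : H, ‖q‖ < 1 → Summable fun m => q ^ m * a m

/-- `a` are the coefficients of a slice regular self-map of the unit ball. -/
def SelfMap (a : ℕ → H) : Prop :=
  SummableOn a ∧ ∀ q : H, ‖q‖ < 1 → ‖evalC a q‖ < 1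

/-- Coefficients of the ∗-product. -/
def starMulC (a b : ℕ → H) : ℕ → H := fun m => ∑ ℓ ∈ Finset.range (m + 1), a (m - ℓ) * b ℓ

/-- Coefficients of the ∗-inverse (of a series with invertible constant term). -/
def starInvC (a : ℕ → H) : ℕ → H
  | 0 => (a 0)⁻¹
  | m + 1 => -(a 0)⁻¹ * ∑ ℓ : Fin (m + 1), a (m + 1 - ℓ.val) * starInvC a ℓ.val
  decreasing_by exact ℓ.isLt

/-- Coefficients of `1 - q p̄`. -/
def oneMinusQPbarC (p : H) : ℕ → H := fun m => if m = 0 then 1 else if m = 1 then -(star p) else 0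

/-- Coefficients of `q - p`. -/
def qMinusPC (p : H) : ℕ → H := fun m => if m = 0 then -p else if m = 1 then 1 else 0

/-- Coefficients of the regular Möbius transformation `ℳ_p = (1 - q p̄)^{-∗} ∗ (q - p)`. -/
def mobiusC (p : H) : ℕ → H := starMulC (starInvC (oneMinusQPbarC p)) (qMinusPC p)

/-- Coefficients of `ℳ_{t₁} ∗ ⋯ ∗ ℳ_{t_κ}`. -/
def blaschkeListC : List H → (ℕ → H)
  | [] => fun m => if m = 0 then 1 else 0
  | t :: ts => starMulC (mobiusC t) (blaschkeListC ts)

/-- `a` are the coefficients of a regular Blaschke product of degree `κ`,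
i.e. of `ℳ_{t₁} ∗ ⋯ ∗ ℳ_{t_κ} u` with the `tᵢ` in `𝔹` and `u` unimodular. -/
def IsBlaschke (a : ℕ → H) (κ : ℕ) : Prop :=
  ∃ (ts : List H) (u : H), ts.length = κ ∧ (∀ t ∈ ts, ‖t‖ < 1) ∧ ‖u‖ = 1 ∧
    a = fun m => blaschkeListC ts m * u

/-- Coefficients of `ℳ_w ∙ f = (1 - f w̄)^{-∗} ∗ (f - w)`. -/
def bulletC (w : H) (a : ℕ → H) : ℕ → H :=
  starMulC (starInvC (fun m => (if m = 0 then (1 : H) else 0) - a m * star w))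
    (fun m => a m - if m = 0 then w else 0)

/-- Coefficients of the regular difference quotient `ℛ_{f,p}`,
the unique slice regular function with `f(q) = f(p) + (q - p) ∗ ℛ_{f,p}(q)`. -/
def diffQuotC (a : ℕ → H) (p : H) : ℕ → H := fun m => ∑' k, p ^ k * a (k + m + 1)

/-- Coefficients of the hyperbolic difference quotient
`f⋆_p = (1 - q p̄) ∗ ℛ_{f,p} ∗ (1 - \overline{f(p)} f)^{-∗} = ℳ_p^{-∗} ∗ (ℳ_{f(p)} ∙ f)`. -/
def hdqC (a : ℕ → H) (p : H) : ℕ → H :=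
  starMulC (starMulC (oneMinusQPbarC p) (diffQuotC a p))
    (starInvC (fun m => (if m = 0 then (1 : H) else 0) - star (evalC a p) * a m))

/-- Iterated hyperbolic difference quotients: `ihdqC a [p₁, …, pₙ] = ((f⋆_{p₁})⋆_{p₂} ⋯)⋆_{pₙ}`. -/
def ihdqC (a : ℕ → H) : List H → (ℕ → H)
  | [] => a
  | p :: ps => ihdqC (hdqC a p) ps

/-- `𝒯_p(q) = (1 - q p)⁻¹ q (1 - q p)`. -/
def mobiusT (p q : H) : H := (1 - q * p)⁻¹ * q * (1 - q * p)

/-- `M_p(q) = (1 - q p̄)⁻¹ (q - p)`. -/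
def mobiusM (p q : H) : H := (1 - q * star p)⁻¹ * (q - p)

/-- Pointwise evaluation of the regular Möbius transformation: `ℳ_p(q) = M_p(𝒯_p(q))`. -/
def mobiusEval (p q : H) : H := mobiusM p (mobiusT p q)

/-- The pseudo-hyperbolic distance `ρ(p,q) = |M_p(q)|`. -/
def rho (p q : H) : ℝ := ‖mobiusM p q‖

/-- The Poincaré distance `δ(p,q) = tanh⁻¹ ρ(p,q) = ½ log((1+ρ)/(1−ρ))`. -/
def pdist (p q : H) : ℝ := (1/2 : ℝ) * Real.log ((1 + rho p q) / (1 - rho p q))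


theorem mem_slice_iff (I : H) (hI : I ^ 2 = -1) (q : H) :
    q ∈ sliceSet I ↔ I * q - q * I = 0 := by
  constructor
  · rintro ⟨x, y, rfl⟩
    rw [mul_add, add_mul, mul_smul_comm, smul_mul_assoc, (Quaternion.coe_commutes x I)]
    simp
  · intro h
    rw [pow_two] at hI
    have ext4 : ∀ y : ℝ, q.imI = y * I.imI → q.imJ = y * I.imJ → q.imK = y * I.imK →
        q = (q.re : H) + y • I ∨ I.re ≠ 0 := by
      intro y h1 h2 h3
      by_cases hr : I.re = 0
      · left
        ext <;> simp [hr, h1, h2, h3]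
      · exact Or.inr hr
    have e0 := congrArg QuaternionAlgebra.re hI
    have e1 := congrArg QuaternionAlgebra.imI hI
    have e2 := congrArg QuaternionAlgebra.imJ hI
    have e3 := congrArg QuaternionAlgebra.imK hI
    have f1 := congrArg QuaternionAlgebra.imI h
    have f2 := congrArg QuaternionAlgebra.imJ h
    have f3 := congrArg QuaternionAlgebra.imK h
    simp at e0 e1 e2 e3 f1 f2 f3
    change _ = -(1 : ℝ) at e0
    change _ = -(0 : ℝ) at e1
    change _ = -(0 : ℝ) at e2
    change _ = -(0 : ℝ) at e3
    change _ = (0 : ℝ) at f1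
    change _ = (0 : ℝ) at f2
    change _ = (0 : ℝ) at f3
    generalize I.re = r at *
    generalize I.imI = i at *
    generalize I.imJ = j at *
    generalize I.imK = k at *
    generalize q.imI = u at *
    generalize q.imJ = v at *
    generalize q.imK = w at *
    have hr : r = 0 := by
      by_contra hr
      have h1 : i = 0 := mul_left_cancel₀ hr (by linarith)
      have h2 : j = 0 := mul_left_cancel₀ hr (by linarith)
      have h3 : k = 0 := mul_left_cancel₀ hr (by linarith)
      subst h1 h2 h3
      nlinarith
    subst hr
    have g1 : j * w - k * v = 0 := by linarith
    have g2 : k * u - i * w = 0 := by linarith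
    have g3 : i * v - j * u = 0 := by linarith
    have g0 : i * i + j * j + k * k = 1 := by linarith
    refine ⟨q.re, i * u + j * v + k * w, (ext4 _ ?_ ?_ ?_).resolve_right (by simp)⟩
    · linear_combination (-u) * g0 + k * g2 - j * g3
    · linear_combination (-v) * g0 - k * g1 + i * g3
    · linear_combination (-w) * g0 + j * g1 - i * g2

/-- If `f(q) = ∑ qᵐ aₘ` converges on `{|q| < R}`, then `f` maps the slice
`{|q| < R} ∩ ℂ_I` into `ℂ_I` iff every coefficient `aₘ` lies in `ℂ_I`. -/
theorem slice_preserving_iff_coeffs_in_slice (R : ℝ) (hR : 0 < R) (a : ℕ → H)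
    (hsum : ∀ q : H, ‖q‖ < R → Summable fun m => q ^ m * a m)
    (I : H) (hI : I ^ 2 = -1) :
    (∀ q : H, ‖q‖ < R → q ∈ sliceSet I → evalC a q ∈ sliceSet I) ↔
      (∀ m : ℕ, a m ∈ sliceSet I) := by
  constructor
  · intro h m
    rw [mem_slice_iff I hI]
    let p : FormalMultilinearSeries ℝ ℝ H := fun n =>
      ContinuousMultilinearMap.mkPiRing ℝ (Fin n) (I * a n - a n * I)
    have hc : ∀ n, p.coeff n = I * a n - a n * I := by
      intro n
      simp [p, FormalMultilinearSeries.coeff]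
    have hp : HasFPowerSeriesAt (0 : ℝ → H) p 0 := by
      rw [hasFPowerSeriesAt_iff]
      filter_upwards [Metric.ball_mem_nhds (0 : ℝ) hR] with z hz
      have hz' : ‖(z : H)‖ < R := by simpa using hz
      have h1 := (hsum z hz').hasSum
      have h2 := (h1.mul_left I).sub (h1.mul_right I)
      have h3 := (mem_slice_iff I hI _).1 (h z hz' ⟨z, 0, by simp⟩)
      rw [evalC] at h3
      rw [h3] at h2
      have h4 : (fun n => z ^ n • p.coeff n) =
          fun b => I * ((z : H) ^ b * a b) - (z : H) ^ b * a b * I := by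
        funext n
        rw [hc, ← Quaternion.coe_pow, Quaternion.coe_mul_eq_smul, mul_smul_comm,
          smul_mul_assoc, smul_sub]
      rw [h4]
      exact h2
    rw [← hc, hp.eq_zero]
    simp [FormalMultilinearSeries.coeff]
  · intro h q hq hqs
    rw [mem_slice_iff I hI]
    have h1 := (hsum q hq).hasSum
    have h2 := (h1.mul_left I).sub (h1.mul_right I)
    refine h2.unique ?_
    convert hasSum_zero using 1
    funext n
    have c1 : Commute I q := sub_eq_zero.1 ((mem_slice_iff I hI _).1 hqs)
    have c2 : Commute I (a n) := sub_eq_zero.1 ((mem_slice_iff I hI _).1 (h n))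
    exact sub_eq_zero.2 ((c1.pow_right n).mul_right c2)

end QPaper
end
end

section
/- Let R > 0 and let a : ℕ → ℍ be a sequence of quaternions such that the series f(q) = Σ_{m≥0} qᵐ aₘ converges for every quaternion q with |q| < R. Then f maps {q ∈ ℍ : |q| < R} ∩ ℂ_I into ℂ_I for every imaginary unit I (i.e. f is slice preserving) if and only if aₘ is real for every m ≥ 0. -/
noncomputable section

namespace QPaper

theorem aux_coeff_zero (R : ℝ) (hR : 0 < R) (c : ℕ → ℝ)
    (h : ∀ r : ℝ, |r| < R → HasSum (fun m => r ^ m * c m) 0) (m : ℕ) : c m = 0 := by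
  have hp : HasFPowerSeriesAt (fun _ : ℝ => (0 : ℝ))
      (FormalMultilinearSeries.ofScalars ℝ c) 0 := by
    refine hasFPowerSeriesAt_iff.2 ?_
    filter_upwards [Metric.ball_mem_nhds (0 : ℝ) hR] with z hz
    have := h z (by simpa using hz)
    simpa [FormalMultilinearSeries.coeff_ofScalars] using this
  have h1 := congrArg (fun p => FormalMultilinearSeries.coeff p m) hp.eq_zero
  simp only [FormalMultilinearSeries.coeff_ofScalars] at h1
  exact h1

theorem aux_slice_eq (I : H) : sliceSet I = (Submodule.span ℝ {(1 : H), I} : Set H) := by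
  ext q
  simp only [sliceSet, Set.mem_ofPred_eq, SetLike.mem_coe, Submodule.mem_span_pair]
  constructor
  · rintro ⟨x, y, rfl⟩
    exact ⟨x, y, by rw [← Algebra.algebraMap_eq_smul_one]; rfl⟩
  · rintro ⟨x, y, rfl⟩
    exact ⟨x, y, by rw [← Algebra.algebraMap_eq_smul_one]; rfl⟩

theorem aux_slice_mul (I : H) (hI : I ^ 2 = -1) (p q : H) (hp : p ∈ sliceSet I)
    (hq : q ∈ sliceSet I) : p * q ∈ sliceSet I := by
  obtain ⟨x, y, rfl⟩ := hp
  obtain ⟨u, v, rfl⟩ := hq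
  refine ⟨x * u - y * v, x * v + y * u, ?_⟩
  have : (y • I) * (v • I) = -((y * v : ℝ) : H) := by
    rw [smul_mul_smul_comm, ← sq, hI, smul_neg, ← Algebra.algebraMap_eq_smul_one]; rfl
  rw [add_mul, mul_add, mul_add, this, Quaternion.coe_mul_eq_smul, Quaternion.coe_mul_eq_smul, Quaternion.mul_coe_eq_smul]
  ext <;> simp <;> ring

theorem aux_real (R : ℝ) (hR : 0 < R) (a : ℕ → H)
    (hsum : ∀ q : H, ‖q‖ < R → Summable fun m => q ^ m * a m)
    (L : H →L[ℝ] ℝ) (hL : ∀ r : ℝ, |r| < R → L (evalC a (r : H)) = 0) (m : ℕ) :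
    L (a m) = 0 := by
  refine aux_coeff_zero R hR (fun m => L (a m)) (fun r hr => ?_) m
  have h1 := (hsum (r : H) (by simpa using hr)).hasSum.mapL L
  have h2 := hL r hr
  unfold evalC at h2
  rw [h2] at h1
  convert h1 using 2 with n
  rw [← Quaternion.coe_pow, Quaternion.coe_mul_eq_smul, map_smul, smul_eq_mul]

/-- If `f(q) = ∑ qᵐ aₘ` converges on `{|q| < R}`, then `f` is slice preserving
(maps `{|q| < R} ∩ ℂ_I` into `ℂ_I` for every imaginary unit `I`) iff every
coefficient `aₘ` is real. -/
theorem slice_preserving_iff_coeffs_real (R : ℝ) (hR : 0 < R) (a : ℕ → H)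
    (hsum : ∀ q : H, ‖q‖ < R → Summable fun m => q ^ m * a m) :
    (∀ I : H, I ^ 2 = -1 →
        ∀ q : H, ‖q‖ < R → q ∈ sliceSet I → evalC a q ∈ sliceSet I) ↔
      (∀ m : ℕ, ∃ x : ℝ, a m = (x : H)) := by
  constructor
  · intro h m
    have key : ∀ r : ℝ, |r| < R → (evalC a (r : H)).imI = 0 ∧ (evalC a (r : H)).imJ = 0 ∧
        (evalC a (r : H)).imK = 0 := by
      intro r hr
      have hr' : ‖(r : H)‖ < R := by simpa using hr
      obtain ⟨I, hI0, hI1, hI2, hI3⟩ : ∃ I : H, I.re = 0 ∧ I.imI = 1 ∧ I.imJ = 0 ∧ I.imK = 0 :=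
        ⟨⟨0, 1, 0, 0⟩, rfl, rfl, rfl, rfl⟩
      obtain ⟨J, hJ0, hJ1, hJ2, hJ3⟩ : ∃ I : H, I.re = 0 ∧ I.imI = 0 ∧ I.imJ = 1 ∧ I.imK = 0 :=
        ⟨⟨0, 0, 1, 0⟩, rfl, rfl, rfl, rfl⟩
      obtain ⟨x, y, h1⟩ := h I (by rw [sq]; ext <;> simp [hI0, hI1, hI2, hI3] <;> rfl) (r : H) hr'
        ⟨r, 0, by simp⟩
      obtain ⟨u, v, h2⟩ := h J (by rw [sq]; ext <;> simp [hJ0, hJ1, hJ2, hJ3] <;> rfl) (r : H) hr'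
        ⟨r, 0, by simp⟩
      refine ⟨?_, ?_, ?_⟩
      · rw [h2]; simp [hJ1]
      · rw [h1]; simp [hI2]
      · rw [h1]; simp [hI3]
    have hI := aux_real R hR a hsum (LinearMap.toContinuousLinearMap
      { toFun := fun q : H => q.imI, map_add' := by simp, map_smul' := by simp })
      (fun r hr => (key r hr).1) m
    have hJ := aux_real R hR a hsum (LinearMap.toContinuousLinearMap
      { toFun := fun q : H => q.imJ, map_add' := by simp, map_smul' := by simp })
      (fun r hr => (key r hr).2.1) m
    have hK := aux_real R hR a hsum (LinearMap.toContinuousLinearMap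
      { toFun := fun q : H => q.imK, map_add' := by simp, map_smul' := by simp })
      (fun r hr => (key r hr).2.2) m
    refine ⟨(a m).re, ?_⟩
    ext
    · simp
    · exact hI
    · exact hJ
    · exact hK
  · intro h I hI q hq hqI
    have hpow : ∀ n : ℕ, q ^ n ∈ sliceSet I := by
      intro n
      induction n with
      | zero => exact ⟨1, 0, by simp⟩
      | succ k ih => rw [pow_succ]; exact aux_slice_mul I hI _ _ ih hqI
    have hterm : ∀ n : ℕ, q ^ n * a n ∈ Submodule.span ℝ {(1 : H), I} := by
      intro n
      obtain ⟨x, hx⟩ := h n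
      have : q ^ n * a n ∈ sliceSet I :=
        aux_slice_mul I hI _ _ (hpow n) ⟨x, 0, by simp [hx]⟩
      rw [aux_slice_eq] at this
      exact this
    rw [aux_slice_eq]
    exact (Submodule.closed_of_finiteDimensional (Submodule.span ℝ {(1 : H), I})).mem_of_tendsto
      (hsum q hq).hasSum (Filter.Eventually.of_forall fun s => Submodule.sum_mem _ fun n _ => hterm n)

end QPaper
end
end

section
/- For every p ∈ 𝔹 and every u ∈ ℍ with |u| = 1, the map q ↦ M_p(𝒯_p(q))·u — which is the pointwise evaluation of the regular Möbius transformation ℳ_p u — is a bijection of 𝔹 onto 𝔹. -/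
noncomputable section

namespace QPaper

theorem aux_ne (a b : H) (ha : ‖a‖ < 1) (hb : ‖b‖ < 1) : 1 - a * b ≠ 0 := by
  intro h
  have h1 : a * b = 1 := (sub_eq_zero.mp h).symm
  have h2 : ‖a‖ * ‖b‖ = 1 := by rw [← norm_mul, h1, norm_one]
  nlinarith [norm_nonneg a, norm_nonneg b]

theorem aux_normT (p q : H) (hp : ‖p‖ < 1) (hq : ‖q‖ < 1) : ‖mobiusT p q‖ = ‖q‖ := by
  have h := norm_ne_zero_iff.mpr (aux_ne q p hq hp)
  unfold mobiusT
  rw [norm_mul, norm_mul, norm_inv]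
  field_simp

theorem aux_self_mul_star (p : H) : p * star p = ((Quaternion.normSq p : ℝ) : H) :=
  Quaternion.self_mul_star p

theorem aux_T (p q : H) (hp : ‖p‖ < 1) (hq : ‖q‖ < 1) :
    mobiusT (star p) (mobiusT p q) = q := by
  have hne := aux_ne q p hq hp
  have hne2 := aux_ne (mobiusT p q) (star p) (by rwa [aux_normT p q hp hq]) (by rwa [norm_star])
  unfold mobiusT at hne2 ⊢
  set a : H := 1 - q * p with ha
  set s : H := a - q * a * star p with hs
  have h1 : 1 - a⁻¹ * q * a * star p = a⁻¹ * s := by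
    rw [hs, mul_sub a⁻¹ a, inv_mul_cancel₀ hne]; simp only [mul_assoc]
  have hs0 : s ≠ 0 := by
    intro h
    rw [h1, h, mul_zero] at hne2
    exact hne2 rfl
  have hsum : p + star p = ((2 * p.re : ℝ) : H) := Quaternion.self_add_star' p
  have hs' : s = 1 - q * ((2 * p.re : ℝ) : H) + q * q * ((Quaternion.normSq p : ℝ) : H) := by
    rw [← hsum, ← aux_self_mul_star, hs, ha]; noncomm_ring
  have hc1 : Commute q ((2 * p.re : ℝ) : H) := (Quaternion.coe_commutes _ q).symm
  have hc2 : Commute q ((Quaternion.normSq p : ℝ) : H) := (Quaternion.coe_commutes _ q).symm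
  have hc : Commute q s := by
    rw [hs']
    exact ((Commute.one_right q).sub_right ((Commute.refl q).mul_right hc1)).add_right
      (((Commute.refl q).mul_right (Commute.refl q)).mul_right hc2)
  rw [h1, mul_inv_rev, inv_inv]
  calc s⁻¹ * a * (a⁻¹ * q * a) * (a⁻¹ * s) = s⁻¹ * (a * a⁻¹) * q * (a * a⁻¹) * s := by
        simp only [mul_assoc]
    _ = s⁻¹ * (q * s) := by rw [mul_inv_cancel₀ hne]; simp [mul_assoc]
    _ = q := by rw [hc.eq, ← mul_assoc, inv_mul_cancel₀ hs0, one_mul]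

theorem aux_id1 (p q : H) :
    ‖1 - q * star p‖ ^ 2 - ‖q - p‖ ^ 2 = (1 - ‖q‖ ^ 2) * (1 - ‖p‖ ^ 2) := by
  simp only [sq, ← Quaternion.normSq_eq_norm_mul_self, Quaternion.normSq_def']
  have e0 : (1 : H).re = 1 := rfl
  have e1 : (1 : H).imI = 0 := rfl
  have e2 : (1 : H).imJ = 0 := rfl
  have e3 : (1 : H).imK = 0 := rfl
  simp
  rw [e0, e1, e2, e3]
  ring

theorem aux_id2 (p q : H) :
    ‖1 + star p * q‖ ^ 2 - ‖q + p‖ ^ 2 = (1 - ‖q‖ ^ 2) * (1 - ‖p‖ ^ 2) := by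
  simp only [sq, ← Quaternion.normSq_eq_norm_mul_self, Quaternion.normSq_def']
  have e0 : (1 : H).re = 1 := rfl
  have e1 : (1 : H).imI = 0 := rfl
  have e2 : (1 : H).imJ = 0 := rfl
  have e3 : (1 : H).imK = 0 := rfl
  simp
  rw [e0, e1, e2, e3]
  ring

theorem aux_lt (a b p q : H) (hp : ‖p‖ < 1) (hq : ‖q‖ < 1)
    (h : ‖a‖ ^ 2 - ‖b‖ ^ 2 = (1 - ‖q‖ ^ 2) * (1 - ‖p‖ ^ 2)) : ‖b‖ < ‖a‖ := by
  have h1 : 0 < 1 - ‖q‖ ^ 2 := by nlinarith [norm_nonneg q]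
  have h2 : 0 < 1 - ‖p‖ ^ 2 := by nlinarith [norm_nonneg p]
  have h3 := mul_pos h1 h2
  exact lt_of_pow_lt_pow_left₀ 2 (norm_nonneg a) (by linarith)

theorem aux_ne2 (p w : H) (hp : ‖p‖ < 1) (hw : ‖w‖ < 1) : 1 + star p * w ≠ 0 := by
  have := aux_ne (-star p) w (by rwa [norm_neg, norm_star]) hw
  simpa using this

theorem aux_M (p : H) (hp : ‖p‖ < 1) :
    Set.BijOn (mobiusM p) {q : H | ‖q‖ < 1} {q : H | ‖q‖ < 1} := by
  refine Set.InvOn.bijOn (f' := fun w => (w + p) * (1 + star p * w)⁻¹) ⟨?_, ?_⟩ ?_ ?_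
  rotate_left 2
  · intro q hq
    have hq : ‖q‖ < 1 := hq
    show ‖mobiusM p q‖ < 1
    have h := aux_lt _ _ p q hp hq (aux_id1 p q)
    have h0 := lt_of_le_of_lt (norm_nonneg _) h
    unfold mobiusM
    rw [norm_mul, norm_inv, inv_mul_lt_iff₀ h0, mul_one]
    exact h
  · intro q hq
    have hq : ‖q‖ < 1 := hq
    show ‖(q + p) * (1 + star p * q)⁻¹‖ < 1
    have h := aux_lt _ _ p q hp hq (aux_id2 p q)
    have h0 := lt_of_le_of_lt (norm_nonneg _) h
    rw [norm_mul, norm_inv, mul_inv_lt_iff₀ h0, one_mul]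
    exact h
  · intro q hq
    have hq : ‖q‖ < 1 := hq
    have hw : ‖mobiusM p q‖ < 1 := by
      have h := aux_lt _ _ p q hp hq (aux_id1 p q)
      have h0 := lt_of_le_of_lt (norm_nonneg _) h
      unfold mobiusM
      rw [norm_mul, norm_inv, inv_mul_lt_iff₀ h0, mul_one]
      exact h
    have hne := aux_ne q (star p) hq (by rwa [norm_star])
    have he : (1 - q * star p) * mobiusM p q = q - p := by
      unfold mobiusM
      rw [← mul_assoc, mul_inv_cancel₀ hne, one_mul]
    show (mobiusM p q + p) * (1 + star p * mobiusM p q)⁻¹ = q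
    rw [mul_inv_eq_iff_eq_mul₀ (aux_ne2 p _ hp hw)]
    rw [sub_mul, one_mul, sub_eq_iff_eq_add] at he
    rw [he, mul_add, mul_one, ← mul_assoc, ← he]
    nth_rewrite 1 [he]
    abel
  · intro w hw
    have hw : ‖w‖ < 1 := hw
    have hq : ‖(w + p) * (1 + star p * w)⁻¹‖ < 1 := by
      have h := aux_lt _ _ p w hp hw (aux_id2 p w)
      have h0 := lt_of_le_of_lt (norm_nonneg _) h
      rw [norm_mul, norm_inv, mul_inv_lt_iff₀ h0, one_mul]
      exact h
    have hne := aux_ne2 p w hp hw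
    show mobiusM p ((w + p) * (1 + star p * w)⁻¹) = w
    have he : ((w + p) * (1 + star p * w)⁻¹) * (1 + star p * w) = w + p := by
      rw [mul_assoc, inv_mul_cancel₀ hne, mul_one]
    generalize (w + p) * (1 + star p * w)⁻¹ = q at hq he ⊢
    unfold mobiusM
    rw [inv_mul_eq_iff_eq_mul₀ (aux_ne q (star p) hq (by rwa [norm_star]))]
    have h2 : q + q * star p * w = w + p := by rw [← he]; noncomm_ring
    have h3 : q = w + p - q * star p * w := by rw [← h2]; abel
    rw [sub_mul, one_mul, sub_eq_iff_eq_add]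
    nth_rewrite 1 [h3]
    abel

theorem aux_Tbij (p : H) (hp : ‖p‖ < 1) :
    Set.BijOn (mobiusT p) {q : H | ‖q‖ < 1} {q : H | ‖q‖ < 1} := by
  have hp' : ‖star p‖ < 1 := by rwa [norm_star]
  refine Set.InvOn.bijOn (f' := mobiusT (star p)) ⟨?_, ?_⟩ ?_ ?_
  · intro q hq
    exact aux_T p q hp hq
  · intro q hq
    have := aux_T (star p) q hp' hq
    rwa [star_star] at this
  · intro q hq
    have hq : ‖q‖ < 1 := hq
    show ‖mobiusT p q‖ < 1
    rwa [aux_normT p q hp hq]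
  · intro q hq
    have hq : ‖q‖ < 1 := hq
    show ‖mobiusT (star p) q‖ < 1
    rwa [aux_normT _ q hp' hq]

theorem aux_U (u : H) (hu : ‖u‖ = 1) :
    Set.BijOn (fun q : H => q * u) {q : H | ‖q‖ < 1} {q : H | ‖q‖ < 1} := by
  have h0 : u ≠ 0 := by
    rw [← norm_ne_zero_iff, hu]; exact one_ne_zero
  refine Set.InvOn.bijOn (f' := fun q => q * u⁻¹) ⟨?_, ?_⟩ ?_ ?_
  · intro q _
    exact mul_inv_cancel_right₀ h0 q
  · intro q _
    exact inv_mul_cancel_right₀ h0 q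
  · intro q hq
    have hq : ‖q‖ < 1 := hq
    show ‖q * u‖ < 1
    rwa [norm_mul, hu, mul_one]
  · intro q hq
    have hq : ‖q‖ < 1 := hq
    show ‖q * u⁻¹‖ < 1
    rwa [norm_mul, norm_inv, hu, inv_one, mul_one]

/-- The pointwise evaluation `q ↦ M_p(𝒯_p(q))·u` of the regular Möbius
transformation `ℳ_p u` is a bijection of the unit ball `𝔹` onto itself. -/
theorem mobius_bijOn_ball (p u : H) (hp : ‖p‖ < 1) (hu : ‖u‖ = 1) :
    Set.BijOn (fun q : H => mobiusEval p q * u) {q : H | ‖q‖ < 1} {q : H | ‖q‖ < 1} := by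
  exact (aux_U u hu).comp ((aux_M p hp).comp (aux_Tbij p hp))

end QPaper
end
end

section
/- Let c₀ ∈ 𝔹 and 0 < r₀ < 1. Then the pseudo-hyperbolic ball {q ∈ 𝔹 : |(1 − q c̄₀)⁻¹ (q − c₀)| < r₀} coincides with the Euclidean ball {q ∈ ℍ : |q − c₁| < r₁}, where c₁ = ((1 − r₀²)/(1 − |c₀|² r₀²))·c₀ and r₁ = ((1 − |c₀|²)/(1 − |c₀|² r₀²))·r₀. -/
noncomputable section

namespace QPaper

theorem normsq_one_sub (q c : H) :
    ‖1 - q * star c‖ ^ 2 = 1 - 2 * inner ℝ q c + ‖q‖ ^ 2 * ‖c‖ ^ 2 := by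
  rw [norm_sub_sq_real, norm_mul, norm_star, norm_one, mul_pow]
  have : inner ℝ (1 : H) (q * star c) = inner ℝ q c := by
    simp [Quaternion.inner_def]
    ring
  rw [this]; ring

theorem alg_id (a b t r D : ℝ) (h : D ≠ 0) (hD : D = 1 - b * r ^ 2) :
    a - 2 * ((1 - r ^ 2) / D * t) + ((1 - r ^ 2) / D) ^ 2 * b - ((1 - b) / D * r) ^ 2 =
      (a - 2 * t + b - r ^ 2 * (1 - 2 * t + a * b)) / D := by
  field_simp
  rw [hD]
  ring

theorem div_neg_iff_of_pos_right' {a b : ℝ} (hb : 0 < b) : a / b < 0 ↔ a < 0 := by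
  rw [div_lt_iff₀ hb, zero_mul]

/-- The pseudo-hyperbolic ball of center `c₀ ∈ 𝔹` and radius `r₀ ∈ (0,1)`
coincides with an explicit Euclidean ball. -/
theorem pseudoHyperbolic_ball_eq_euclidean_ball (c₀ : H) (hc : ‖c₀‖ < 1)
    (r₀ : ℝ) (hr0 : 0 < r₀) (hr1 : r₀ < 1) :
    {q : H | ‖q‖ < 1 ∧ ‖(1 - q * star c₀)⁻¹ * (q - c₀)‖ < r₀} =
      {q : H | ‖q - ((1 - r₀ ^ 2) / (1 - ‖c₀‖ ^ 2 * r₀ ^ 2)) • c₀‖ <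
        ((1 - ‖c₀‖ ^ 2) / (1 - ‖c₀‖ ^ 2 * r₀ ^ 2)) * r₀} := by
  have hb0 : (0:ℝ) ≤ ‖c₀‖ ^ 2 := by positivity
  have hb1 : ‖c₀‖ ^ 2 < 1 := by nlinarith [norm_nonneg c₀]
  have hr2 : r₀ ^ 2 < 1 := by nlinarith
  have hD : 0 < 1 - ‖c₀‖ ^ 2 * r₀ ^ 2 := by nlinarith [sq_nonneg r₀]
  ext q
  simp only [Set.mem_setOf_eq]
  have key := normsq_one_sub q c₀
  have h1 : ‖q - c₀‖ ^ 2 = ‖q‖ ^ 2 - 2 * inner ℝ q c₀ + ‖c₀‖ ^ 2 := norm_sub_sq_real q c₀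
  have h2 : ∀ s : ℝ, ‖q - s • c₀‖ ^ 2 =
      ‖q‖ ^ 2 - 2 * (s * inner ℝ q c₀) + s ^ 2 * ‖c₀‖ ^ 2 := by
    intro s
    rw [norm_sub_sq_real, inner_smul_right, norm_smul, mul_pow, Real.norm_eq_abs, sq_abs]
  have hR : 0 ≤ ((1 - ‖c₀‖ ^ 2) / (1 - ‖c₀‖ ^ 2 * r₀ ^ 2)) * r₀ :=
    mul_nonneg (div_nonneg (by linarith) hD.le) hr0.le
  rw [← sq_lt_sq₀ (norm_nonneg (q - _)) hR, h2]
  have hB : ‖q‖ ^ 2 - 2 * ((1 - r₀ ^ 2) / (1 - ‖c₀‖ ^ 2 * r₀ ^ 2) * inner ℝ q c₀) +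
        ((1 - r₀ ^ 2) / (1 - ‖c₀‖ ^ 2 * r₀ ^ 2)) ^ 2 * ‖c₀‖ ^ 2 -
        ((1 - ‖c₀‖ ^ 2) / (1 - ‖c₀‖ ^ 2 * r₀ ^ 2) * r₀) ^ 2 =
      (‖q - c₀‖ ^ 2 - r₀ ^ 2 * ‖1 - q * star c₀‖ ^ 2) / (1 - ‖c₀‖ ^ 2 * r₀ ^ 2) := by
    rw [key, h1]
    exact alg_id _ _ _ _ _ hD.ne' rfl
  rw [← sub_neg (b := (_ * r₀) ^ 2), hB, div_neg_iff_of_pos_right' hD, sub_neg, ← mul_pow,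
    sq_lt_sq₀ (norm_nonneg _) (by positivity)]
  have hpos : 0 < ‖1 - q * star c₀‖ →
      (‖(1 - q * star c₀)⁻¹ * (q - c₀)‖ < r₀ ↔ ‖q - c₀‖ < r₀ * ‖1 - q * star c₀‖) := by
    intro h
    rw [norm_mul, norm_inv, inv_mul_eq_div, div_lt_iff₀ h]
  have hid : ‖1 - q * star c₀‖ ^ 2 - ‖q - c₀‖ ^ 2 = (1 - ‖q‖ ^ 2) * (1 - ‖c₀‖ ^ 2) := by
    rw [key, h1]; ring
  constructor
  · rintro ⟨hq, h⟩
    refine (hpos ?_).1 h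
    have : ‖q‖ ^ 2 < 1 := by nlinarith [norm_nonneg q]
    have : 0 < (1 - ‖q‖ ^ 2) * (1 - ‖c₀‖ ^ 2) := mul_pos (by linarith) (by linarith)
    have h3 : 0 < ‖1 - q * star c₀‖ ^ 2 := by nlinarith [sq_nonneg ‖q - c₀‖]
    exact lt_of_le_of_ne (norm_nonneg _) (fun h0 => by rw [← h0] at h3; norm_num at h3)
  · intro h
    have hp : 0 < ‖1 - q * star c₀‖ := by
      by_contra hn
      nlinarith [norm_nonneg (q - c₀), norm_nonneg (1 - q * star c₀)]
    refine ⟨?_, (hpos hp).2 h⟩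
    have hlt : ‖q - c₀‖ < ‖1 - q * star c₀‖ := by nlinarith
    have : 0 < (1 - ‖q‖ ^ 2) * (1 - ‖c₀‖ ^ 2) := by
      rw [← hid]; nlinarith [norm_nonneg (q - c₀)]
    have := pos_of_mul_pos_left this (by linarith)
    nlinarith [norm_nonneg q]

end QPaper
end
end

section
/- For all p, q ∈ 𝔹 one has the identity M_p(q) = −(1 − q p̄)⁻¹ (1 − p q̄) M_q(p), the factor −(1 − q p̄)⁻¹ (1 − p q̄) has modulus one, and consequently the pseudo-hyperbolic distance is symmetric: |(1 − q p̄)⁻¹ (q − p)| = |(1 − p q̄)⁻¹ (p − q)|. -/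
noncomputable section

namespace QPaper

/-- `M_p(q) = −(1 − q p̄)⁻¹ (1 − p q̄) M_q(p)`, the factor has modulus one, and
hence the pseudo-hyperbolic distance is symmetric. -/
theorem mobius_symm (p q : H) (hp : ‖p‖ < 1) (hq : ‖q‖ < 1) :
    mobiusM p q = -((1 - q * star p)⁻¹ * (1 - p * star q)) * mobiusM q p ∧
    ‖-((1 - q * star p)⁻¹ * (1 - p * star q))‖ = 1 ∧
    ‖(1 - q * star p)⁻¹ * (q - p)‖ = ‖(1 - p * star q)⁻¹ * (p - q)‖ := by
  have key : ∀ a b : H, ‖a‖ < 1 → ‖b‖ < 1 → (1 - a * star b) ≠ 0 := by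
    intro a b ha hb h
    have h1 : a * star b = 1 := (sub_eq_zero.mp h).symm
    have h2 : ‖a‖ * ‖b‖ = 1 := by
      have := congrArg norm h1
      rwa [norm_mul, norm_star, norm_one] at this
    nlinarith [norm_nonneg a, norm_nonneg b]
  have hA := key q p hq hp
  have hB := key p q hp hq
  have hn : ‖1 - p * star q‖ = ‖1 - q * star p‖ := by
    rw [← norm_star (1 - q * star p)]
    simp
  have hm : mobiusM p q = -((1 - q * star p)⁻¹ * (1 - p * star q)) * mobiusM q p := by
    unfold mobiusM
    rw [neg_mul, mul_assoc, mul_inv_cancel_left₀ hB, ← mul_neg, neg_sub]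
  refine ⟨hm, ?_, ?_⟩
  · rw [norm_neg, norm_mul, norm_inv, hn]
    exact inv_mul_cancel₀ (norm_ne_zero_iff.mpr hA)
  · rw [norm_mul, norm_mul, norm_inv, norm_inv, hn, norm_sub_rev q p]

end QPaper
end
end

section
/- Let B be a regular Blaschke product of degree κ and let q₀ ∈ 𝔹. Then ℳ_{q₀} ∙ B is again a regular Blaschke product of degree κ. Conversely, if f is a slice regular self-map of 𝔹 such that ℳ_{q₀} ∙ f is a regular Blaschke product of degree κ, then f is a regular Blaschke product of degree κ. -/
noncomputable section

namespace QPaper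

open PowerSeries in
theorem mk_star (a b : ℕ → H) : PowerSeries.mk (starMulC a b) = PowerSeries.mk a * PowerSeries.mk b := by
  ext n : 1
  rw [PowerSeries.coeff_mul, PowerSeries.coeff_mk, ← Finset.Nat.sum_antidiagonal_swap,
    Finset.Nat.sum_antidiagonal_eq_sum_range_succ_mk]
  simp [starMulC]

theorem mk_inj {a b : ℕ → H} (h : PowerSeries.mk a = PowerSeries.mk b) : a = b := by
  funext n
  simpa using congrArg (PowerSeries.coeff n) h

theorem starInv_mul (a : ℕ → H) (h0 : a 0 ≠ 0) :
    PowerSeries.mk a * PowerSeries.mk (starInvC a) = 1 := by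
  rw [← mk_star]
  ext n : 1
  rw [PowerSeries.coeff_mk, PowerSeries.coeff_one]
  cases n with
  | zero => simp [starMulC, starInvC, h0]
  | succ m =>
    simp only [starMulC]
    rw [Finset.sum_range_succ]
    rw [starInvC, Fin.sum_univ_eq_sum_range (fun l => a (m + 1 - l) * starInvC a l) (m+1)]
    simp only [Nat.sub_self, ← mul_assoc, mul_neg, mul_inv_cancel₀ h0]
    simp

theorem mk_cancel {a : ℕ → H} (h0 : a 0 ≠ 0) {X Y : PowerSeries H}
    (h : PowerSeries.mk a * X = PowerSeries.mk a * Y) : X = Y := by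
  refine mul_left_cancel₀ ?_ h
  intro h
  apply h0
  simpa using congrArg (PowerSeries.coeff 0) h

theorem mob_coeff (p : H) : mobiusC p = fun n => match n with
    | 0 => -p
    | n + 1 => (1 - (‖p‖ ^ 2 : ℝ)) • (star p) ^ n := by
  apply mk_inj
  have h0 : oneMinusQPbarC p 0 ≠ 0 := by simp [oneMinusQPbarC]
  apply mk_cancel h0
  rw [mobiusC, mk_star, ← mul_assoc, starInv_mul _ h0, one_mul, ← mk_star]
  congr 1
  funext n
  have key : star p * p = ((‖p‖ ^ 2 : ℝ) : H) := by
    rw [Quaternion.star_mul_self, Quaternion.normSq_eq_norm_mul_self, sq]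
  match n with
  | 0 => simp [starMulC, oneMinusQPbarC, qMinusPC]
  | 1 =>
    simp [starMulC, oneMinusQPbarC, qMinusPC, Finset.sum_range_succ, key, sub_smul]
    simp [Algebra.smul_def]
  | n + 2 =>
    have : ∀ l ∈ Finset.range (n+1), oneMinusQPbarC p (n + 2 - l) = 0 := by
      intro l hl
      have := Finset.mem_range.1 hl
      simp [oneMinusQPbarC, show n + 2 - l ≠ 0 by omega, show n + 2 - l ≠ 1 by omega]
    simp only [starMulC]
    rw [Finset.sum_range_succ, Finset.sum_range_succ, Finset.sum_eq_zero]
    · simp [oneMinusQPbarC, qMinusPC, pow_succ']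
    · intro l hl
      rw [this l hl, zero_mul]

theorem starMul_const (a b : ℕ → H) (u : H) :
    (fun m => starMulC a b m * u) = starMulC a (fun m => b m * u) := by
  funext m
  simp [starMulC, Finset.sum_mul, mul_assoc]

theorem starMul_assoc (a b c : ℕ → H) : starMulC (starMulC a b) c = starMulC a (starMulC b c) := by
  apply mk_inj
  simp only [mk_star, mul_assoc]

theorem const_starMul (a b : ℕ → H) (u : H) :
    starMulC (fun m => a m * u) b = starMulC a (fun m => u * b m) := by
  funext m
  simp [starMulC, mul_assoc]

theorem blaschke_append (l : List H) (t : H) :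
    blaschkeListC (l ++ [t]) = starMulC (blaschkeListC l) (mobiusC t) := by
  induction l with
  | nil =>
    apply mk_inj
    have : PowerSeries.mk (fun m => if m = 0 then (1:H) else 0) = 1 := by
      ext n : 1
      simp [PowerSeries.coeff_one]
    simp [blaschkeListC, mk_star, this]
  | cons a l ih => simp [blaschkeListC, ih, starMul_assoc]

theorem unit_star {u : H} (hu : ‖u‖ = 1) : star u * u = 1 ∧ u * star u = 1 := by
  rw [Quaternion.star_mul_self, Quaternion.self_mul_star, Quaternion.normSq_eq_norm_mul_self, hu]
  simp

theorem mob_conj (p u : H) (hu : ‖u‖ = 1) (n : ℕ) :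
    u * mobiusC p n = mobiusC (u * p * star u) n * u := by
  obtain ⟨h1, h2⟩ := unit_star hu
  rw [mob_coeff, mob_coeff]
  cases n with
  | zero => simp [mul_assoc, h1]
  | succ n =>
    have : ∀ n, (u * star p * star u) ^ n * u = u * star p ^ n := by
      intro n
      induction n with
      | zero => simp
      | succ n ih =>
        rw [pow_succ, mul_assoc]
        have : u * star p * star u * u = u * star p := by simp [mul_assoc, h1]
        rw [this, ← mul_assoc, ih, pow_succ, mul_assoc]
    simp [← mul_assoc, this, hu]

theorem blaschke_snoc {g : ℕ → H} {n : ℕ} (hg : IsBlaschke g n) {p u : H} (hp : ‖p‖ < 1)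
    (hu : ‖u‖ = 1) : IsBlaschke (starMulC g (fun m => mobiusC p m * u)) (n + 1) := by
  obtain ⟨ts, v, hl, ht, hv, rfl⟩ := hg
  refine ⟨ts ++ [v * p * star v], v * u, by simp [hl], ?_, by simp [hv, hu], ?_⟩
  · intro t h
    simp only [List.mem_append, List.mem_singleton] at h
    rcases h with h | rfl
    · exact ht _ h
    · simpa [hv] using hp
  · rw [const_starMul, blaschke_append]
    rw [starMul_const]
    congr 1
    funext m
    rw [← mul_assoc, mob_conj p v hv, mul_assoc]

theorem bullet_eq {w : H} {a : ℕ → H} (h0 : 1 - a 0 * star w ≠ 0) (n : ℕ) :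
    bulletC w a n = starMulC (fun m => (if m = 0 then 1 else 0) + bulletC w a m * star w) a n
      - if n = 0 then w else 0 := by
  set P : ℕ → H := fun m => (if m = 0 then (1 : H) else 0) - a m * star w with hP
  have hP0 : P 0 ≠ 0 := by simpa [hP] using h0
  set F := PowerSeries.mk (bulletC w a) with hF
  set α := PowerSeries.mk a
  have hPm : PowerSeries.mk P = 1 - α * PowerSeries.C (star w) := by
    ext n : 1
    simp [hP, α, PowerSeries.coeff_one]
  have hN : PowerSeries.mk (fun m => a m - if m = 0 then w else 0) = α - PowerSeries.C w := by
    ext n : 1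
    simp [α, PowerSeries.coeff_C]
  have h1 : PowerSeries.mk P * F = α - PowerSeries.C w := by
    rw [hF, bulletC, mk_star, ← mul_assoc, starInv_mul P hP0, one_mul, hN]
  have hc : PowerSeries.C (star w) * PowerSeries.C w = PowerSeries.C w * PowerSeries.C (star w) := by
    rw [← map_mul, ← map_mul, Quaternion.star_mul_self, Quaternion.self_mul_star]
  have hc2 : PowerSeries.C w * PowerSeries.C (star w) * α = α * (PowerSeries.C w * PowerSeries.C (star w)) := by
    rw [← map_mul, Quaternion.self_mul_star]
    ext n : 1
    simp [Quaternion.coe_commutes]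
  have h2 : F * (1 - PowerSeries.C (star w) * α) = α - PowerSeries.C w := by
    apply mk_cancel hP0
    rw [← mul_assoc, h1, hPm]
    simp only [sub_mul, mul_sub, one_mul, mul_one]
    simp only [← mul_assoc, hc2]
    rw [mul_assoc α (PowerSeries.C (star w)) (PowerSeries.C w), hc]
    noncomm_ring
  have h3 : F = PowerSeries.mk (starMulC (fun m => (if m = 0 then 1 else 0) + bulletC w a m * star w) a)
      - PowerSeries.C w := by
    have : PowerSeries.mk (fun m => (if m = 0 then 1 else 0) + bulletC w a m * star w)
      = 1 + F * PowerSeries.C (star w) := by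
      ext n : 1
      simp [F, PowerSeries.coeff_one]
    rw [mk_star, this, add_mul, one_mul, mul_assoc]
    change F = α + _ - _
    rw [add_sub_right_comm, ← h2]
    noncomm_ring
  have := congrArg (PowerSeries.coeff n) h3
  simpa [F, PowerSeries.coeff_C] using this

theorem bullet_inv {w : H} {a : ℕ → H} (h0 : 1 - a 0 * star w ≠ 0)
    (h1 : 1 + bulletC w a 0 * star w ≠ 0) : bulletC (-w) (bulletC w a) = a := by
  set P : ℕ → H := fun m => (if m = 0 then (1 : H) else 0) - bulletC w a m * star (-w) with hP
  have hP0 : P 0 ≠ 0 := by simpa [hP] using h1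
  apply mk_inj
  apply mk_cancel hP0
  rw [bulletC, mk_star, ← mul_assoc, starInv_mul P hP0, one_mul, ← mk_star]
  congr 1
  funext n
  have := bullet_eq h0 n
  rw [hP]
  simp only [star_neg, mul_neg, sub_neg_eq_add]
  rw [eq_sub_iff_add_eq] at this
  rw [← this]
  split_ifs <;> simp

theorem resp {V : Type} [AddCommGroup V] [Module H V] (A : V →ₗ[H] V) (b : V) (c : V →ₗ[H] H)
    (d : H) (g : ℕ → H) (g0 : g 0 = d) (gs : ∀ n, g (n + 1) = c ((A ^ n) b)) (z : ℕ → H)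
    (v : ℕ → V) (v0 : v 0 = z 0 • b) (vs : ∀ n, v (n + 1) = A (v n) + z (n + 1) • b) :
    starMulC z g 0 = z 0 * d ∧ ∀ n, starMulC z g (n + 1) = c (v n) + z (n + 1) * d := by
  have hv : ∀ n, v n = ∑ l ∈ Finset.range (n + 1), z (n - l) • (A ^ l) b := by
    intro n
    induction n with
    | zero => simp [v0]
    | succ n ih =>
      rw [vs, ih, Finset.sum_range_succ' _ (n + 1), map_sum]
      simp [pow_succ']
  refine ⟨by simp [starMulC, g0], fun n => ?_⟩
  rw [hv, starMulC, Finset.sum_range_succ', map_sum, g0]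
  simp [gs]

theorem exists_eig {V : Type} [AddCommGroup V] [Module H V] [Module.Finite H V] [Nontrivial V]
    (A : V →ₗ[H] V) : ∃ (l : H) (v : V), v ≠ 0 ∧ A v = l • v := by
  let φ : ℂ →+* H := (Quaternion.ofComplex : ℂ →ₐ[ℝ] H).toRingHom
  let m1 : Module ℂ H := Module.compHom H φ
  let m2 : Module ℂ V := Module.compHom V φ
  have t1 : IsScalarTower ℂ H V := ⟨fun x y z => by
    change (φ x * y) • z = φ x • (y • z)
    rw [mul_smul]⟩
  have t2 : IsScalarTower ℝ ℂ H := ⟨fun x y z => by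
    change φ (x • y) * z = x • (φ y * z)
    have : φ (x • y) = x • φ y := map_smul (Quaternion.ofComplex : ℂ →ₐ[ℝ] H) x y
    rw [this, smul_mul_assoc]⟩
  have f1 : Module.Finite ℂ H := Module.Finite.of_restrictScalars_finite ℝ ℂ H
  have f2 : Module.Finite ℂ V := Module.Finite.trans H V
  let B : Module.End ℂ V :=
    { toFun := A, map_add' := A.map_add, map_smul' := fun x v => A.map_smul (φ x) v }
  obtain ⟨μ, hμ⟩ := Module.End.exists_eigenvalue B
  obtain ⟨v, hv⟩ := hμ.exists_hasEigenvector
  exact ⟨φ μ, v, hv.2, hv.apply_eq_smul⟩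

structure IsForm {V : Type} [AddCommGroup V] [Module H V] (h : V → V → H) : Prop where
  add_left : ∀ u u' v, h (u + u') v = h u v + h u' v
  smul_left : ∀ (x : H) u v, h (x • u) v = x * h u v
  symm : ∀ u v, star (h u v) = h v u
  pos : ∀ v, v ≠ 0 → 0 < (h v v).re

namespace IsForm
variable {V : Type} [AddCommGroup V] [Module H V] {h : V → V → H}

theorem add_right (H1 : IsForm h) (u v v' : V) : h u (v + v') = h u v + h u v' := by
  rw [← H1.symm, H1.add_left, star_add, H1.symm, H1.symm]

theorem smul_right (H1 : IsForm h) (x : H) (u v : V) : h u (x • v) = h u v * star x := by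
  rw [← H1.symm, H1.smul_left, star_mul, H1.symm]

theorem zero_left (H1 : IsForm h) (v : V) : h 0 v = 0 := by
  have := H1.smul_left 0 0 v
  simpa using this

theorem self_real (H1 : IsForm h) (v : V) : h v v = ((h v v).re : H) :=
  Quaternion.star_eq_self.1 (H1.symm v v)

theorem nonneg (H1 : IsForm h) (v : V) : 0 ≤ (h v v).re := by
  by_cases hv : v = 0
  · rw [hv, H1.zero_left]; exact le_rfl
  · exact (H1.pos v hv).le

theorem smul_smul (H1 : IsForm h) (x : H) (v : V) :
    (h (x • v) (x • v)).re = ‖x‖ ^ 2 * (h v v).re := by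
  rw [H1.smul_left, H1.smul_right, H1.self_real, Quaternion.coe_commutes, ← mul_assoc,
    Quaternion.self_mul_star, Quaternion.normSq_eq_norm_mul_self, ← Quaternion.coe_mul, sq]
  simp
end IsForm

theorem mul_star_re (x : H) : (x * star x).re = ‖x‖ ^ 2 := by
  rw [Quaternion.self_mul_star, Quaternion.normSq_eq_norm_mul_self, sq]
  simp

structure IsSys {V : Type} [AddCommGroup V] [Module H V] (h : V → V → H) (A : V →ₗ[H] V) (b : V)
    (c : V →ₗ[H] H) (d : H) (f : ℕ → H) : Prop where
  form : IsForm h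
  iso : ∀ v v' x x', h (A v + x • b) (A v' + x' • b) + (c v + x * d) * star (c v' + x' * d)
    = h v v' + x * star x'
  obs : ∀ v (l : H), A v = l • v → c v = 0 → v = 0
  f0 : f 0 = d
  fs : ∀ n, f (n + 1) = c ((A ^ n) b)

def Realz (κ : ℕ) (f : ℕ → H) : Prop :=
  ∃ (V : Type) (_ : AddCommGroup V) (_ : Module H V) (h : V → V → H) (A : V →ₗ[H] V) (b : V)
    (c : V →ₗ[H] H) (d : H), Module.Finite H V ∧ Module.finrank H V = κ ∧ IsSys h A b c d f

section
variable {V : Type} [AddCommGroup V] [Module H V] {h : V → V → H} {A : V →ₗ[H] V} {b : V}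
    {c : V →ₗ[H] H} {d : H} {f : ℕ → H}

theorem IsSys.norm_le (S : IsSys h A b c d f) : ‖d‖ ≤ 1 := by
  have h1 := S.iso 0 0 1 1
  have h2 := congrArg QuaternionAlgebra.re h1
  simp only [map_zero, zero_add, one_smul, one_mul, Quaternion.re_add, mul_star_re,
    S.form.zero_left, star_one, Quaternion.re_zero, Quaternion.re_one] at h2
  have := S.form.nonneg b
  nlinarith [norm_nonneg d]

theorem IsSys.bullet (S : IsSys h A b c d f) {w : H} (hw : ‖w‖ < 1) :
    ∃ h' A' b' c' d', IsSys (V := V) h' A' b' c' d' (bulletC w f) := by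
  have hd := S.norm_le
  have hne : 1 - f 0 * star w ≠ 0 := by
    intro h0
    have := congrArg norm (sub_eq_zero.1 h0)
    rw [S.f0, norm_mul, norm_one, norm_star] at this
    nlinarith [norm_nonneg d, norm_nonneg w]
  have hne2 : 1 - star w * d ≠ 0 := by
    intro h0
    have := congrArg norm (sub_eq_zero.1 h0)
    rw [norm_mul, norm_one, norm_star] at this
    nlinarith [norm_nonneg d, norm_nonneg w]
  set k := (1 - star w * d)⁻¹ with hk
  have hk1 : k + -(k * (star w * d)) = 1 := by
    have := inv_mul_cancel₀ hne2
    rw [mul_sub, mul_one] at this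
    rw [← sub_eq_add_neg, hk, this]
  have hk2 : (1 - star w * d) * k = 1 := mul_inv_cancel₀ hne2
  set F := bulletC w f with hF
  set G : ℕ → H := fun m => (if m = 0 then 1 else 0) + F m * star w with hG
  have hFG : ∀ n, F n = starMulC G f n - if n = 0 then w else 0 := bullet_eq hne
  let v : ℕ → V := fun n => Nat.rec (G 0 • b) (fun n v => A v + G (n + 1) • b) n
  have v0 : v 0 = G 0 • b := rfl
  have vs : ∀ n, v (n + 1) = A (v n) + G (n + 1) • b := fun n => rfl
  obtain ⟨r0, rs⟩ := resp A b c d f S.f0 S.fs G v v0 vs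
  have e0 : F 0 = (1 + F 0 * star w) * d - w := by
    have := hFG 0
    rw [r0] at this
    simpa [hG] using this
  have es : ∀ n, F (n + 1) = c (v n) * k := by
    intro n
    have := hFG (n + 1)
    rw [rs] at this
    simp [hG] at this
    have h2 : F (n + 1) * (1 - star w * d) = c (v n) := by
      rw [mul_sub, mul_one, sub_eq_iff_eq_add, ← mul_assoc]
      exact this
    rw [← h2, mul_assoc, hk2, mul_one]
  let A' : V →ₗ[H] V := A + (LinearMap.toSpanSingleton H V ((k * star w) • b)) ∘ₗ c
  let c' : V →ₗ[H] H := (LinearMap.toSpanSingleton H H k) ∘ₗ c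
  have hA' : ∀ u, A' u = A u + (c u * k * star w) • b := by
    intro u
    simp [A', smul_smul, mul_assoc]
  have hc' : ∀ u, c' u = c u * k := by
    intro u
    simp [c']
  have hv : ∀ n, v n = (A' ^ n) (G 0 • b) := by
    intro n
    induction n with
    | zero => simp [v0]
    | succ n ih =>
      rw [pow_succ', Module.End.mul_apply, ← ih, hA', vs, ← es]
      simp [hG]
  have hs : 0 < 1 - ‖w‖ ^ 2 := by nlinarith [norm_nonneg w]
  set s := 1 - ‖w‖ ^ 2 with hsd
  refine ⟨fun u v => (s⁻¹ : ℝ) • h u v, A', G 0 • b, c', F 0, ⟨?_, ?_, ?_, ?_⟩, ?_, ?_, rfl, ?_⟩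
  · intro u u' v
    simp [S.form.add_left]
  · intro x u v
    simp [S.form.smul_left]
  · intro u v
    simp [← S.form.symm v u]
  · intro v hv
    have := S.form.pos v hv
    simp only [Quaternion.re_smul, smul_eq_mul]
    positivity
  · intro u u' x x'
    have hG0 : G 0 = 1 + F 0 * star w := by simp [hG]
    have key : ∀ u x, A' u + x • (G 0 • b) = A u + (x + (c' u + x * F 0) * star w) • b ∧
        c u + (x + (c' u + x * F 0) * star w) * d = (c' u + x * F 0) + x * w := by
      intro u x
      constructor
      · rw [hA', hc', smul_smul, hG0, add_assoc, ← add_smul]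
        congr 2
        noncomm_ring
      · rw [hc']
        have e1 : c u = c u * k - c u * k * star w * d := by
          conv_lhs => rw [← mul_one (c u), ← hk1]
          noncomm_ring
        have e2 : x * F 0 + x * w = x * d + x * F 0 * star w * d := by
          conv_lhs => rw [e0]
          noncomm_ring
        have E1 := sub_eq_zero.2 e1
        have E2 := sub_eq_zero.2 e2
        rw [← sub_eq_zero]
        calc _ = (c u - (c u * k - c u * k * star w * d)) -
              (x * F 0 + x * w - (x * d + x * F 0 * star w * d)) := by noncomm_ring
          _ = 0 := by rw [E1, E2, sub_zero]
    obtain ⟨k1, k2⟩ := key u x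
    obtain ⟨k1', k2'⟩ := key u' x'
    have I := S.iso u u' (x + (c' u + x * F 0) * star w) (x' + (c' u' + x' * F 0) * star w)
    rw [k2, k2', ← k1, ← k1'] at I
    generalize c' u + x * F 0 = p at *
    generalize c' u' + x' * F 0 = p' at *
    generalize h (A' u + x • G 0 • b) (A' u' + x' • G 0 • b) = α at *
    have hww : w * star w = ((‖w‖ ^ 2 : ℝ) : H) := by
      rw [Quaternion.self_mul_star, Quaternion.normSq_eq_norm_mul_self, sq]
    have hww' : star w * w = ((‖w‖ ^ 2 : ℝ) : H) := by
      rw [Quaternion.star_mul_self, Quaternion.normSq_eq_norm_mul_self, sq]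
    have q1 : x * w * (star w * star x') = (‖w‖ ^ 2 : ℝ) • (x * star x') := by
      rw [mul_assoc, ← mul_assoc w, hww, Quaternion.coe_mul_eq_smul]
      simp
    have q2 : p * star w * (w * star p') = (‖w‖ ^ 2 : ℝ) • (p * star p') := by
      rw [mul_assoc, ← mul_assoc (star w), hww', Quaternion.coe_mul_eq_smul]
      simp
    have : α + s • (p * star p') = h u u' + s • (x * star x') := by
      simp only [star_add, star_mul, star_star, add_mul, mul_add, q1, q2] at I
      rw [hsd, sub_smul, sub_smul, one_smul, one_smul]
      have I' := sub_eq_zero.2 I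
      rw [← sub_eq_zero, ← I']
      noncomm_ring
    have t := congrArg (fun z => s⁻¹ • z) this
    simpa [smul_smul, hs.ne'] using t
  · intro v l h1 h2
    rw [hc'] at h2
    have hk0 : k ≠ 0 := inv_ne_zero hne2
    have h3 : c v = 0 := by simpa [hk0] using h2
    refine S.obs v l ?_ h3
    rw [hA', h3] at h1
    simpa using h1
  · intro n
    rw [es, hv, hc']

theorem IsSys.cascade (S : IsSys h A b c d f) {t : H} (ht : ‖t‖ < 1) :
    ∃ h' A' b' c' d', IsSys (V := V × H) h' A' b' c' d' (starMulC (mobiusC t) f) := by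
  have hs : 0 < 1 - ‖t‖ ^ 2 := by nlinarith [norm_nonneg t]
  set g : ℝ := Real.sqrt (1 - ‖t‖ ^ 2) with hg
  have hg2 : g * g = 1 - ‖t‖ ^ 2 := Real.mul_self_sqrt hs.le
  let A' : (V × H) →ₗ[H] (V × H) :=
    { toFun := fun p => (A p.1 + (g • p.2) • b, p.2 * star t)
      map_add' := fun p q => by
        ext1
        · simp [add_smul]; abel
        · simp [add_mul]
      map_smul' := fun x p => by
        ext1
        · simp only [Prod.smul_fst, map_smul, Prod.smul_snd, RingHom.id_apply, smul_add, _root_.smul_smul, smul_eq_mul, mul_smul_comm]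
        · simp [mul_assoc] }
  let c' : (V × H) →ₗ[H] H :=
    { toFun := fun p => c p.1 + (g • p.2) * d
      map_add' := fun p q => by
        simp [add_mul]; abel
      map_smul' := fun x p => by
        simp [mul_add, mul_assoc] }
  let h' : (V × H) → (V × H) → H := fun p q => h p.1 q.1 + p.2 * star q.2
  let b' : V × H := (-(t • b), (g : H))
  have hform : IsForm h' := by
    refine ⟨?_, ?_, ?_, ?_⟩
    · intro u u' v
      simp only [h', Prod.fst_add, Prod.snd_add, S.form.add_left, add_mul]; abel
    · intro x u v
      simp [h', S.form.smul_left, mul_add, mul_assoc]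
    · intro u v
      simp [h', S.form.symm]
    · rintro ⟨v, μ⟩ hv
      simp only [h', Quaternion.re_add, mul_star_re]
      have h1 := S.form.nonneg v
      by_cases hv0 : v = 0
      · have : μ ≠ 0 := by
          rintro rfl
          exact hv (by simp [hv0])
        have := norm_pos_iff.2 this
        positivity
      · have := S.form.pos v hv0
        positivity
  have hiso : ∀ v v' x x', h' (A' v + x • b') (A' v' + x' • b') +
      (c' v + x * (-(t * d))) * star (c' v' + x' * (-(t * d))) = h' v v' + x * star x' := by
    rintro ⟨v, μ⟩ ⟨v', μ'⟩ x x'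
    have I := S.iso v v' (g • μ - x * t) (g • μ' - x' * t)
    have k1 : ∀ v μ x, (A' (v, μ) + x • b') = (A v + (g • μ - x * t) • b, μ * star t + g • x) := by
      intro v μ x
      ext1
      · simp [A', b', sub_smul, _root_.smul_smul]; abel
      · simp [A', b', Quaternion.mul_coe_eq_smul]
    have k2 : ∀ v μ x, c' (v, μ) + x * (-(t * d)) = c v + (g • μ - x * t) * d := by
      intro v μ x
      simp only [c', LinearMap.coe_mk, AddHom.coe_mk, sub_mul]
      noncomm_ring
    rw [k1, k1, k2, k2]
    simp only [h']
    rw [add_right_comm, I]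
    have htt : t * star t = ((‖t‖ ^ 2 : ℝ) : H) := by
      rw [Quaternion.self_mul_star, Quaternion.normSq_eq_norm_mul_self, sq]
    have htt' : star t * t = ((‖t‖ ^ 2 : ℝ) : H) := by
      rw [Quaternion.star_mul_self, Quaternion.normSq_eq_norm_mul_self, sq]
    have q1 : x * t * (star t * star x') = (‖t‖ ^ 2 : ℝ) • (x * star x') := by
      rw [mul_assoc, ← mul_assoc t, htt, Quaternion.coe_mul_eq_smul]
      simp
    have q2 : μ * star t * (t * star μ') = (‖t‖ ^ 2 : ℝ) • (μ * star μ') := by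
      rw [mul_assoc, ← mul_assoc (star t), htt', Quaternion.coe_mul_eq_smul]
      simp
    have hss : ∀ (r : ℝ) (y : H), star (r • y) = r • star y := by intro r y; simp
    simp only [star_add, star_sub, star_mul, star_star, hss, add_mul, mul_add, sub_mul, mul_sub, q1, q2,
      smul_mul_assoc, mul_smul_comm, smul_add, smul_sub, _root_.smul_smul, hg2, sub_smul, one_smul, mul_assoc]
    abel
  refine ⟨h', A', b', c', -(t * d), hform, hiso, ?_, ?_, ?_⟩
  · rintro ⟨v, μ⟩ l h1 h2
    have hμ : μ = 0 := by
      by_contra hμ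
      have h3 : μ * star t = l * μ := congrArg Prod.snd h1
      have h4 : ‖l‖ = ‖t‖ := by
        have := congrArg norm h3
        rw [norm_mul, norm_mul, norm_star, mul_comm] at this
        exact (mul_right_cancel₀ (norm_ne_zero_iff.2 hμ) this).symm
      have h5 := congrArg QuaternionAlgebra.re (hiso (v, μ) (v, μ) 0 0)
      simp only [zero_smul, add_zero, zero_mul, h2, h1, hform.smul_smul] at h5
      have := hform.pos (v, μ) (by simp [hμ])
      rw [h4] at h5
      nlinarith
    subst hμ
    have h3 : A v + (g • (0 : H)) • b = l • v := congrArg Prod.fst h1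
    have h4 : c v + (g • (0 : H)) * d = 0 := h2
    simp only [smul_zero, zero_smul, add_zero, zero_mul] at h3 h4
    rw [S.obs v l h3 h4]
    rfl
  all_goals
    have hb : ∀ n, ((A' ^ n) b').2 = g • star t ^ n := by
      intro n
      induction n with
      | zero => simp [b', Algebra.smul_def]
      | succ n ih =>
        rw [pow_succ', Module.End.mul_apply]
        change ((A' ^ n) b').2 * star t = _
        rw [ih, pow_succ, smul_mul_assoc]
    have R := resp A b c d f S.f0 S.fs (mobiusC t) (fun n => ((A' ^ n) b').1)
      (by simp [b', mob_coeff]) (fun n => by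
        rw [pow_succ', Module.End.mul_apply]
        change A _ + (g • ((A' ^ n) b').2) • b = _
        rw [hb, mob_coeff, _root_.smul_smul, hg2])
  · rw [R.1, mob_coeff]
    simp
  · intro n
    rw [R.2]
    change _ = c _ + (g • ((A' ^ n) b').2) * d
    rw [hb, mob_coeff, _root_.smul_smul, hg2]
end

theorem real_of_blaschke {f : ℕ → H} {κ : ℕ} (hf : IsBlaschke f κ) : Realz κ f := by
  obtain ⟨ts, u, hl, ht, hu, rfl⟩ := hf
  induction ts generalizing κ with
  | nil =>
    subst hl
    refine ⟨PUnit, inferInstance, inferInstance, fun _ _ => 0, 0, 0, 0, u, inferInstance,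
      Module.finrank_zero_of_subsingleton,
      ⟨by simp, by simp, by simp, fun v hv => (hv rfl).elim⟩, ?_, by intros; rfl, by simp [blaschkeListC], by simp [blaschkeListC]⟩
    intro v v' x x'
    simp only [LinearMap.zero_apply, zero_add, star_mul]
    rw [mul_assoc, ← mul_assoc u, (unit_star hu).2, one_mul]
  | cons t ts ih =>
    obtain ⟨V, _, _, h, A, b, c, d, hfin, hr, S⟩ := ih rfl (fun t h => ht t (by simp [h]))
    obtain ⟨h', A', b', c', d', S'⟩ := S.cascade (ht t (by simp))
    refine ⟨V × H, _, _, h', A', b', c', d', inferInstance, ?_, ?_⟩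
    · rw [Module.finrank_prod, hr, ← hl]; simp
    · simp only [blaschkeListC]
      rw [starMul_const]
      exact S'

theorem blaschke_of_real (κ : ℕ) : ∀ f : ℕ → H, Realz κ f → IsBlaschke f κ := by
  induction κ with
  | zero =>
    rintro f ⟨V, _, _, h, A, b, c, d, hfin, hr, S⟩
    have hsub : Subsingleton V := Module.finrank_zero_iff.1 hr
    refine ⟨[], d, rfl, by simp, ?_, ?_⟩
    · have h2 := congrArg QuaternionAlgebra.re (S.iso 0 0 1 1)
      rw [Subsingleton.elim b 0] at h2
      simp only [map_zero, zero_add, one_smul, one_mul, Quaternion.re_add, mul_star_re,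
        S.form.zero_left, star_one, Quaternion.re_zero, Quaternion.re_one] at h2
      nlinarith [norm_nonneg d]
    · funext n
      cases n with
      | zero => simp [blaschkeListC, S.f0]
      | succ n => rw [S.fs, Subsingleton.elim ((A ^ n) b) 0]; simp [blaschkeListC]
  | succ κ ih =>
    rintro f ⟨V, _, _, h, A, b, c, d, hfin, hr, S⟩
    have hnt : Nontrivial V := Module.nontrivial_of_finrank_pos (R := H) (by omega)
    obtain ⟨l, v, hv0, hv1, hAv⟩ : ∃ (l : H) (v : V), v ≠ 0 ∧ h v v = 1 ∧ A v = l • v := by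
      obtain ⟨l, v, hv0, hAv⟩ := exists_eig A
      have hp := S.form.pos v hv0
      set r := (h v v).re with hr
      have hsq := Real.mul_self_sqrt hp.le
      have hs0 := Real.sqrt_pos.2 hp
      refine ⟨l, (((Real.sqrt r)⁻¹ : ℝ) : H) • v, ?_, ?_, ?_⟩
      · rw [Ne, smul_eq_zero]
        rintro (h | h)
        · have : ((Real.sqrt r)⁻¹ : ℝ) = 0 := by
            exact congrArg QuaternionAlgebra.re h
          exact (inv_pos.2 hs0).ne' this
        · exact hv0 h
      · rw [S.form.smul_left, S.form.smul_right, S.form.self_real, ← hr, Quaternion.star_coe,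
          ← Quaternion.coe_mul, ← Quaternion.coe_mul]
        have : (Real.sqrt r)⁻¹ * (r * (Real.sqrt r)⁻¹) = 1 := by
          field_simp
          nlinarith
        rw [this]; simp
      · rw [map_smul, hAv, smul_smul, smul_smul, Quaternion.coe_commutes]
    set γ := c v with hγ
    have hγ0 : γ ≠ 0 := fun h0 => hv0 (S.obs v l hAv h0)
    have hlg : ‖l‖ ^ 2 + ‖γ‖ ^ 2 = 1 := by
      have h2 := congrArg QuaternionAlgebra.re (S.iso v v 0 0)
      simp only [zero_smul, add_zero, zero_mul, Quaternion.re_add, mul_star_re,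
        hAv, S.form.smul_smul, hv1, Quaternion.re_one, mul_one] at h2
      exact h2
    have hγp : 0 < ‖γ‖ := norm_pos_iff.2 hγ0
    have hl1 : ‖l‖ < 1 := by nlinarith [norm_nonneg l]
    set e := ‖γ‖ with he
    set δ : H := -(e⁻¹ • (star l * γ)) with hδ
    have hδ2 : δ * star δ = ((‖l‖ ^ 2 : ℝ) : H) := by
      rw [Quaternion.self_mul_star, Quaternion.normSq_eq_norm_mul_self, hδ, norm_neg, norm_smul,
        norm_mul, norm_star, ← he, norm_inv, Real.norm_of_nonneg hγp.le]
      congr 1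
      field_simp
    have hperp : ∀ u x, h u v = 0 → c u + x * d = (e⁻¹ • (h (A u + x • b) v)) * δ := by
      intro u x hu
      have I := S.iso u v x 0
      rw [zero_smul, add_zero, zero_mul, add_zero, star_zero, mul_zero, add_zero, hAv,
        S.form.smul_right, ← hγ, hu] at I
      have hgg : star γ * γ = ((e * e : ℝ) : H) := by
        rw [Quaternion.star_mul_self, Quaternion.normSq_eq_norm_mul_self]
      have I2 : (h (A u + x • b) v * star l + (c u + x * d) * star γ) * γ = 0 := by
        rw [I, zero_mul]
      rw [add_mul, mul_assoc _ (star γ), hgg, Quaternion.mul_coe_eq_smul, mul_assoc] at I2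
      have I3 := eq_neg_of_add_eq_zero_right I2
      have I4 := congrArg (fun z => (e⁻¹ * e⁻¹) • z) I3
      simp only [smul_smul] at I4
      rw [show e⁻¹ * e⁻¹ * (e * e) = 1 by field_simp, one_smul] at I4
      rw [I4, hδ]
      simp [smul_smul]
    let φ : V →ₗ[H] H :=
      { toFun := fun u => h u v
        map_add' := fun u u' => S.form.add_left u u' v
        map_smul' := fun x u => S.form.smul_left x u v }
    have hφ : ∀ u, φ u = h u v := fun u => rfl
    have hφv : φ v = 1 := hv1
    let W := LinearMap.ker φ
    have hWr : Module.finrank H W = κ := by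
      have h1 := LinearMap.finrank_range_add_finrank_ker φ
      have h2 : LinearMap.range φ = ⊤ := by
        rw [LinearMap.range_eq_top]
        intro x
        exact ⟨x • v, by rw [map_smul, hφv]; simp⟩
      rw [h2, finrank_top, Module.finrank_self, hr] at h1
      change 1 + Module.finrank H W = κ + 1 at h1
      omega
    let pr : V →ₗ[H] W := LinearMap.codRestrict W
      (LinearMap.id - (LinearMap.toSpanSingleton H V v) ∘ₗ φ) (fun u => by
        change φ _ = 0
        simp [hφv])
    have hpr : ∀ u, ((pr u : W) : V) = u - φ u • v := fun u => by simp [pr]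
    have hprv : pr v = 0 := by
      apply Subtype.ext
      rw [hpr, hφv]; simp
    have hprW : ∀ u : W, pr (u : V) = u := by
      intro u
      apply Subtype.ext
      have : φ (u : V) = 0 := u.2
      rw [hpr, this]; simp
    have hhpr : ∀ y y', h (pr y : V) (pr y' : V) = h y y' - φ y * star (φ y') := by
      intro y y'
      have h1 : h y y' = h ((pr y : V) + φ y • v) ((pr y' : V) + φ y' • v) := by
        rw [hpr, hpr]; simp
      have h2 : h (pr y : V) v = 0 := (pr y).2
      have h3 : h v (pr y' : V) = 0 := by
        rw [← S.form.symm]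
        have : h (pr y' : V) v = 0 := (pr y').2
        rw [this, star_zero]
      rw [h1]
      simp only [S.form.add_left, S.form.add_right, S.form.smul_left, S.form.smul_right, h2, h3, hv1]
      simp
    let AW : W →ₗ[H] W := pr ∘ₗ A ∘ₗ W.subtype
    let cW : W →ₗ[H] H := (LinearMap.toSpanSingleton H H ((e⁻¹ : ℝ) : H)) ∘ₗ φ ∘ₗ A ∘ₗ W.subtype
    have hAW : ∀ u, AW u = pr (A u) := fun u => rfl
    have hcW : ∀ u, cW u = e⁻¹ • φ (A u) := fun u => by
      simp only [cW, LinearMap.comp_apply, LinearMap.toSpanSingleton_apply, smul_eq_mul,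
        Quaternion.mul_coe_eq_smul]
      rfl
    let g : ℕ → H := fun n => match n with
      | 0 => e⁻¹ • φ b
      | n + 1 => cW ((AW ^ n) (pr b))
    have hprA : ∀ y, AW (pr y) = pr (A y) := by
      intro y
      rw [hAW, hpr, map_sub, map_smul, hAv, map_sub, map_smul, map_smul, hprv]
      simp
    have hw : ∀ n, (AW ^ n) (pr b) = pr ((A ^ n) b) := by
      intro n
      induction n with
      | zero => simp
      | succ n ih => rw [pow_succ', pow_succ', Module.End.mul_apply, Module.End.mul_apply, ih, hprA]
    have hg : IsBlaschke g κ := by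
      apply ih
      refine ⟨W, inferInstance, inferInstance, fun u u' => h u u', AW, pr b, cW, e⁻¹ • φ b,
        inferInstance, hWr, ⟨?_, ?_, ?_, ?_⟩, ?_, ?_, rfl, fun n => rfl⟩
      · intro u u' v; exact S.form.add_left _ _ _
      · intro x u v; exact S.form.smul_left _ _ _
      · intro u v; exact S.form.symm _ _
      · intro u hu
        exact S.form.pos _ (fun h0 => hu (Subtype.ext h0))
      · intro u u' x x'
        have I := S.iso u u' x x'
        rw [hperp u x u.2, hperp u' x' u'.2] at I
        have k1 : ∀ (u : W) (x : H), AW u + x • pr b = pr (A u + x • b) := by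
          intro u x
          rw [hAW, map_add, map_smul]
        have k2 : ∀ (u : W) (x : H), cW u + x * e⁻¹ • φ b = e⁻¹ • φ (A u + x • b) := by
          intro u x
          rw [hcW, map_add, map_smul, smul_add, smul_eq_mul, mul_smul_comm]
        rw [k1, k1, k2, k2, hhpr, ← I]
        rw [← hφ, ← hφ, star_mul, mul_assoc _ δ, ← mul_assoc δ, hδ2]
        generalize φ (A u + x • b) = α
        generalize φ (A u' + x' • b) = α'
        rw [Quaternion.coe_mul_eq_smul]
        have : ∀ (r : ℝ) (y : H), star (r • y) = r • star y := by intro r y; simp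
        rw [this]
        simp only [smul_mul_assoc, mul_smul_comm, smul_smul]
        have h5 : e⁻¹ * e⁻¹ = 1 + ‖l‖ ^ 2 * (e⁻¹ * e⁻¹) := by
          field_simp
          linarith
        rw [sub_add, sub_eq_add_neg]
        congr 1
        rw [neg_sub, sub_eq_iff_eq_add, ← one_smul ℝ (α * star α'), smul_smul, smul_smul, ← add_smul]
        congr 1
        nlinarith [h5]
      · intro u l' h1 h2
        have h3 : φ (A u) = 0 := by
          rw [hcW] at h2
          simpa [hγp.ne'] using h2
        have h4 : A u = l' • (u : V) := by
          have := congrArg Subtype.val h1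
          rw [hAW, hpr, h3] at this
          simpa using this
        have h5 : c u = 0 := by
          have := hperp u 0 u.2
          rw [zero_smul, add_zero, zero_mul, add_zero, ← hφ, h3] at this
          simpa using this
        exact Subtype.ext (S.obs u l' h4 h5)
    have hu : ‖e⁻¹ • γ‖ = 1 := by
      rw [norm_smul, norm_inv, Real.norm_of_nonneg hγp.le, ← he]
      field_simp
    have hfin2 := blaschke_snoc hg (p := star l) (u := e⁻¹ • γ) (by rwa [norm_star]) hu
    convert hfin2 using 1
    have hdec : ∀ y, y = (pr y : V) + φ y • v := fun y => by rw [hpr]; simp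
    have hpow : ∀ n, ((LinearMap.toSpanSingleton H H l) ^ n) (e : H) = e • l ^ n := by
      intro n
      induction n with
      | zero => simp [Algebra.smul_def]
      | succ n ih => rw [pow_succ', Module.End.mul_apply, ih]; simp [pow_succ]
    have hgs : ∀ n, g (n + 1) = e⁻¹ • φ (A (pr ((A ^ n) b) : V)) := by
      intro n
      change cW _ = _
      rw [hw, hcW]
    have R := resp (LinearMap.toSpanSingleton H H l) (e : H) (LinearMap.toSpanSingleton H H γ) δ
      (fun m => mobiusC (star l) m * e⁻¹ • γ) (by simp [mob_coeff, hδ])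
      (fun n => by
        rw [mob_coeff, hpow]
        simp only [norm_star, star_star, LinearMap.toSpanSingleton_apply, smul_eq_mul,
          smul_mul_assoc, mul_smul_comm, smul_smul]
        congr 1
        rw [← hlg]
        field_simp
        ring) g (fun n => φ ((A ^ n) b))
      (by
        change φ ((A ^ 0) b) = (e⁻¹ • φ b) • (e : H)
        rw [smul_eq_mul, Quaternion.mul_coe_eq_smul, smul_smul, mul_inv_cancel₀ hγp.ne']
        simp)
      (fun n => by
        rw [hgs, pow_succ', Module.End.mul_apply, smul_eq_mul, Quaternion.mul_coe_eq_smul, smul_smul,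
          mul_inv_cancel₀ hγp.ne', one_smul]
        conv_lhs => rw [hdec ((A ^ n) b)]
        rw [map_add, map_smul, hAv, map_add, map_smul, map_smul, hφv, add_comm]
        simp)
    funext n
    cases n with
    | zero =>
      rw [R.1, S.f0]
      have := hperp 0 1 (S.form.zero_left v)
      change d = (e⁻¹ • h b v) * δ
      simpa using this
    | succ n =>
      rw [R.2, S.fs, hgs]
      conv_lhs => rw [hdec ((A ^ n) b)]
      have := hperp (pr ((A ^ n) b) : V) 0 (pr ((A ^ n) b)).2
      rw [zero_smul, add_zero, zero_mul, add_zero, ← hφ] at this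
      rw [map_add, this, map_smul, add_comm]
      simp [← hγ]

theorem blaschke_bullet {κ : ℕ} {w : H} (hw : ‖w‖ < 1) {f : ℕ → H} (hf : IsBlaschke f κ) :
    IsBlaschke (bulletC w f) κ := by
  obtain ⟨V, i1, i2, h, A, b, c, d, hfin, hr, S⟩ := real_of_blaschke hf
  obtain ⟨h', A', b', c', d', S'⟩ := S.bullet hw
  exact blaschke_of_real κ _ ⟨V, i1, i2, h', A', b', c', d', hfin, hr, S'⟩

theorem blaschke_norm {κ : ℕ} {f : ℕ → H} (hf : IsBlaschke f κ) : ‖f 0‖ ≤ 1 := by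
  obtain ⟨V, i1, i2, h, A, b, c, d, hfin, hr, S⟩ := real_of_blaschke hf
  rw [S.f0]
  exact S.norm_le

/-- `ℳ_{q₀} ∙ B` is a regular Blaschke product of degree `κ` whenever `B` is;
conversely, if `f` is a slice regular self-map of `𝔹` with `ℳ_{q₀} ∙ f` a
regular Blaschke product of degree `κ`, then so is `f`. -/
theorem bullet_blaschke_degree (κ : ℕ) (q₀ : H) (hq₀ : ‖q₀‖ < 1) :
    (∀ b : ℕ → H, IsBlaschke b κ → IsBlaschke (bulletC q₀ b) κ) ∧
    (∀ a : ℕ → H, SelfMap a → IsBlaschke (bulletC q₀ a) κ → IsBlaschke a κ) := by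
  refine ⟨fun b hb => blaschke_bullet hq₀ hb, fun a ha hB => ?_⟩
  have h0 : ‖a 0‖ < 1 := by
    have := ha.2 0 (by simp)
    rw [evalC, tsum_eq_single 0 (by intro m hm; simp [hm])] at this
    simpa using this
  have hF := blaschke_norm hB
  have h1 : 1 - a 0 * star q₀ ≠ 0 := by
    intro h
    have := congrArg norm (sub_eq_zero.1 h)
    rw [norm_mul, norm_one, norm_star] at this
    nlinarith [norm_nonneg (a 0), norm_nonneg q₀]
  have h2 : 1 + bulletC q₀ a 0 * star q₀ ≠ 0 := by
    intro h
    have := congrArg norm (eq_neg_of_add_eq_zero_left h)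
    rw [norm_neg, norm_mul, norm_one, norm_star] at this
    nlinarith [norm_nonneg (bulletC q₀ a 0), norm_nonneg q₀]
  rw [← bullet_inv h1 h2]
  exact blaschke_bullet (by rwa [norm_neg]) hB


end QPaper
end
end

section
/- Let f be a slice regular self-map of 𝔹, let p ∈ 𝔹 and let r ∈ (−1,1) ⊂ ℝ. Then |(1 − f(r)·\overline{f(p)})⁻¹ (f(r) − f(p))| ≤ |(1 − r p)⁻¹ (r − p)|, i.e. ρ(f(p), f(r)) ≤ ρ(p, r). -/
noncomputable section

namespace QPaper

section abs
set_option linter.unusedSectionVars false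
variable {A : Type*} [CStarAlgebra A] [Nontrivial A]

structure Emb (φ : H →+* A) : Prop where
  hs : ∀ q, φ (star q) = star (φ q)
  hr : ∀ x : ℝ, φ (x : H) = algebraMap ℂ A (x : ℂ)

lemma Emb.norm_mul {φ : H →+* A} (h : Emb φ) (X : A) (q : H) : ‖X * φ q‖ = ‖X‖ * ‖q‖ := by
  have h1 : ‖X * φ q‖ * ‖X * φ q‖ = (‖X‖ * ‖q‖) * (‖X‖ * ‖q‖) := by
    rw [← CStarRing.norm_self_mul_star (x := X * φ q)]
    have : X * φ q * star (X * φ q) = ((‖q‖ * ‖q‖ : ℝ) : ℂ) • (X * star X) := by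
      rw [star_mul, ← h.hs, mul_assoc, ← mul_assoc (φ q), ← map_mul, Quaternion.self_mul_star,
        h.hr, Quaternion.normSq_eq_norm_mul_self, ← mul_assoc, ← Algebra.commutes, mul_assoc, Algebra.smul_def]
    rw [this, norm_smul, CStarRing.norm_self_mul_star, Complex.norm_real, Real.norm_of_nonneg (by positivity)]
    ring
  exact (mul_self_inj (by positivity) (by positivity)).1 h1

lemma Emb.norm_eq {φ : H →+* A} (h : Emb φ) (q : H) : ‖φ q‖ = ‖q‖ := by
  simpa using h.norm_mul 1 q

lemma exists_unit : ∃ I : H, I.re = 0 ∧ ‖I‖ = 1 := by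
  refine ⟨((Complex.I : ℂ) : H), by simp, ?_⟩
  have := Quaternion.normSq_eq_norm_mul_self ((Complex.I : ℂ) : H)
  rw [Quaternion.normSq_def'] at this
  simp at this
  nlinarith [norm_nonneg ((Complex.I : ℂ) : H)]

lemma quat_best (α β : H) : ∃ I : H, I.re = 0 ∧ ‖I‖ = 1 ∧
    ‖α + I * β‖ ^ 2 = ‖α‖ ^ 2 + ‖β‖ ^ 2 + ‖β * star α - α * star β‖ := by
  have key : ∀ I : H, I.re = 0 → ‖I‖ = 1 → ‖α + I * β‖ ^ 2 = ‖α‖ ^ 2 + ‖β‖ ^ 2 + (I * (β * star α - α * star β)).re := by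
    intro I h0 h1
    have h2 : ‖I * β‖ ^ 2 = ‖β‖ ^ 2 := by rw [norm_mul, h1, one_mul]
    have h3 := norm_add_sq_real α (I * β)
    rw [h3, h2, Quaternion.inner_def]
    simp [h0]
    ring
  set w := β * star α - α * star β with hw
  have hwre : w.re = 0 := by simp [hw]; ring
  by_cases h : w = 0
  · obtain ⟨I, h0, h1⟩ := exists_unit
    refine ⟨I, h0, h1, ?_⟩
    rw [key I h0 h1, h, mul_zero, norm_zero]
    rfl
  · have hn : ‖w‖ ≠ 0 := norm_ne_zero_iff.2 h
    have hI0 : (-(‖w‖⁻¹ • w)).re = 0 := by simp [hwre]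
    have hI1 : ‖-(‖w‖⁻¹ • w)‖ = 1 := by rw [norm_neg, norm_smul]; simp [hn]
    refine ⟨-(‖w‖⁻¹ • w), hI0, hI1, ?_⟩
    rw [key _ hI0 hI1]
    have h2 : (w * w).re = - (‖w‖ * ‖w‖) := by
      rw [← Quaternion.normSq_eq_norm_mul_self, Quaternion.normSq_def', Quaternion.re_mul, hwre]; ring
    rw [neg_mul, smul_mul_assoc, Quaternion.re_neg, Quaternion.re_smul, h2, smul_eq_mul]
    field_simp
    

lemma Emb.contr {φ : H →+* A} (h : Emb φ) (α β : H)
    (hb : ∀ I : H, I.re = 0 → ‖I‖ = 1 → ‖α + I * β‖ < 1) : ‖φ α + Complex.I • φ β‖ ≤ 1 := by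
  obtain ⟨I, h0, h1, h2⟩ := quat_best α β
  have h3 := hb I h0 h1
  have h4 : ‖α + I * β‖ ^ 2 ≤ 1 := by nlinarith [norm_nonneg (α + I * β)]
  have : ‖φ α + Complex.I • φ β‖ * ‖φ α + Complex.I • φ β‖ ≤ 1 := by
    rw [← CStarRing.norm_self_mul_star]
    have e : (φ α + Complex.I • φ β) * star (φ α + Complex.I • φ β) =
        φ ((‖α‖ ^ 2 + ‖β‖ ^ 2 : ℝ) : H) + Complex.I • φ (β * star α - α * star β) := by
      have e1 : ((‖α‖ ^ 2 + ‖β‖ ^ 2 : ℝ) : H) = α * star α + β * star β := by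
        rw [Quaternion.self_mul_star, Quaternion.self_mul_star, Quaternion.normSq_eq_norm_mul_self,
          Quaternion.normSq_eq_norm_mul_self, ← Quaternion.coe_add, sq, sq]
      rw [e1]
      simp only [map_add, map_sub, map_mul, h.hs, star_add, star_smul, Complex.star_def, Complex.conj_I, add_mul, mul_add,
        smul_mul_assoc, smul_sub, neg_smul]
      have eI : ∀ X : A, Complex.I • Complex.I • X = -X := by
        intro X; rw [smul_smul, Complex.I_mul_I, neg_one_smul]
      simp only [mul_neg, mul_smul_comm, smul_mul_assoc, smul_neg, eI, neg_neg]
      abel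
    rw [e]
    refine (norm_add_le _ _).trans ?_
    rw [norm_smul, h.norm_eq, h.norm_eq, Quaternion.norm_coe, Complex.norm_I, one_mul, Real.norm_of_nonneg (by positivity), ← h2]
    exact h4
  nlinarith [norm_nonneg (φ α + Complex.I • φ β)]

lemma Emb.mob {φ : H →+* A} (h : Emb φ) (F : A) (hF : ‖F‖ ≤ 1) (a : H) (ha : ‖a‖ < 1) :
    IsUnit (1 - F * φ (star a)) ∧ ‖Ring.inverse (1 - F * φ (star a)) * (F - φ a)‖ ≤ 1 := by
  have hu : IsUnit (1 - F * φ (star a)) := by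
    apply isUnit_one_sub_of_norm_lt_one
    rw [h.norm_mul, norm_star]
    nlinarith [norm_nonneg F, norm_nonneg a]
  refine ⟨hu, ?_⟩
  let _ := CStarAlgebra.spectralOrder A
  have _ := CStarAlgebra.spectralOrderedRing A
  set D := 1 - F * φ (star a) with hD
  set N := Ring.inverse D with hN
  have hND : N * D = 1 := Ring.inverse_mul_cancel _ hu
  set c : ℝ := ‖a‖ * ‖a‖ with hc
  have hc1 : 0 ≤ 1 - c := by nlinarith [norm_nonneg a]
  have h1 : F * star F ≤ 1 := by
    refine (CStarAlgebra.norm_le_one_iff_of_nonneg _ (mul_star_self_nonneg F)).1 ?_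
    rw [CStarRing.norm_self_mul_star]; nlinarith [norm_nonneg F]
  have h2 : 0 ≤ (1 - c) • (1 - F * star F) := smul_nonneg hc1 (sub_nonneg.2 h1)
  have hac : φ a * star (φ a) = algebraMap ℂ A (c : ℂ) := by
    rw [← h.hs, ← map_mul, Quaternion.self_mul_star, h.hr, Quaternion.normSq_eq_norm_mul_self]
  have hca : star (φ a) * φ a = algebraMap ℂ A (c : ℂ) := by
    rw [← h.hs, ← map_mul, Quaternion.star_mul_self, h.hr, Quaternion.normSq_eq_norm_mul_self]
  have h3 : (1 - c) • (1 - F * star F) = D * star D - (F - φ a) * star (F - φ a) := by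
    have e1 : F * star (φ a) * (φ a * star F) = c • (F * star F) := by
      rw [mul_assoc, ← mul_assoc (star (φ a)), hca, ← mul_assoc, ← Algebra.commutes, mul_assoc, ← Algebra.smul_def]
      exact Complex.coe_smul c _
    have e2 : φ a * star (φ a) = c • (1 : A) := by
      rw [hac, Algebra.algebraMap_eq_smul_one]; exact Complex.coe_smul c _
    simp only [hD, h.hs, star_sub, star_mul, star_star, star_one, sub_mul, mul_sub, one_mul, mul_one, e1, e2, sub_smul, smul_sub, one_smul]
    abel
  have h4 := star_right_conjugate_nonneg h2 N
  rw [h3] at h4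
  have h5 : N * (D * star D - (F - φ a) * star (F - φ a)) * star N = 1 - (N * (F - φ a)) * star (N * (F - φ a)) := by
    have : N * (D * star D) * star N = 1 := by
      rw [← mul_assoc, hND, one_mul, ← star_mul, hND, star_one]
    rw [mul_sub, sub_mul, this, star_mul]
    simp only [mul_assoc]
  rw [h5, sub_nonneg] at h4
  have h6 := (CStarAlgebra.norm_le_one_iff_of_nonneg _ (mul_star_self_nonneg _)).2 h4
  rw [CStarRing.norm_self_mul_star] at h6
  nlinarith [norm_nonneg (N * (F - φ a))]

lemma schwarz_real (G : ℂ → A) (hG : DifferentiableOn ℂ G (Metric.ball 0 1))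
    (hb : ∀ z : ℂ, ‖z‖ < 1 → ‖G z‖ ≤ 1) (r : ℝ) (h1 : -1 < r) (h2 : r < 1) (h0 : G r = 0)
    (z : ℂ) (hz : ‖z‖ < 1) : ‖G z‖ ≤ ‖(1 - r * z)⁻¹ * (r - z)‖ := by
  have ident : ∀ w : ℂ, ∀ s : ℝ, ‖1 + s * w‖ ^ 2 - ‖w + s‖ ^ 2 = (1 - s ^ 2) * (1 - ‖w‖ ^ 2) := by
    intro w s
    simp only [Complex.sq_norm, Complex.normSq_apply]
    simp; ring
  have hr2 : r ^ 2 < 1 := by nlinarith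
  have gen : ∀ s : ℝ, s ^ 2 < 1 → ∀ w : ℂ, ‖w‖ < 1 → 1 + s * w ≠ 0 ∧ ‖(w + s) / (1 + s * w)‖ < 1 := by
    intro s hs w hw
    have := ident w s
    have hp : 0 < (1 - s ^ 2) * (1 - ‖w‖ ^ 2) := by
      apply mul_pos <;> nlinarith [norm_nonneg w]
    have hlt : ‖w + s‖ < ‖1 + s * w‖ := by
      apply lt_of_pow_lt_pow_left₀ 2 (norm_nonneg _); linarith
    have hpos := (norm_nonneg _).trans_lt hlt
    refine ⟨norm_pos_iff.1 hpos, ?_⟩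
    rw [norm_div, div_lt_one hpos]; exact hlt
  have hS := Complex.norm_le_norm_of_mapsTo_ball (f := fun w : ℂ => G ((w + r) / (1 + r * w))) (R := 1)
    (z := (z + ((-r : ℝ) : ℂ)) / (1 + ((-r : ℝ) : ℂ) * z)) ?_ ?_ (by simpa using h0) (gen _ (by simpa using hr2) z hz).2
  · obtain ⟨hne, -⟩ := gen (-r) (by simpa using hr2) z hz
    have e : ((z + ((-r : ℝ) : ℂ)) / (1 + ((-r : ℝ) : ℂ) * z) + r) / (1 + r * ((z + ((-r : ℝ) : ℂ)) / (1 + ((-r : ℝ) : ℂ) * z))) = z := by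
      have h3 : (1 : ℂ) - r ^ 2 ≠ 0 := by
        have : (1 : ℝ) - r ^ 2 ≠ 0 := by linarith
        exact_mod_cast this
      push_cast at hne ⊢
      have e1 : (z + -(r:ℂ)) / (1 + -r * z) + r = z * (1 - r ^ 2) / (1 + -r * z) := by
        rw [eq_div_iff hne, add_mul, div_mul_cancel₀ _ hne]; ring
      have e2 : 1 + r * ((z + -(r:ℂ)) / (1 + -r * z)) = (1 - r ^ 2) / (1 + -r * z) := by
        rw [eq_div_iff hne, add_mul, mul_assoc, div_mul_cancel₀ _ hne]; ring
      rw [e1, e2, div_div_div_cancel_right₀ hne, mul_div_cancel_right₀ _ h3]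
    simp only [e] at hS
    refine hS.trans_eq ?_
    rw [norm_mul, norm_inv, norm_div, div_eq_inv_mul, ← norm_neg (z + _)]
    push_cast
    congr 2
    · congr 1; ring_nf
    · ring
  · refine hG.comp (t := Metric.ball 0 1) (f := fun w : ℂ => (w + r) / (1 + r * w)) ?_ ?_
    · intro w hw
      have := (gen r hr2 w (by simpa using hw)).1
      refine DifferentiableAt.differentiableWithinAt ?_
      fun_prop (disch := assumption)
    · intro w hw
      simpa using (gen r hr2 w (by simpa using hw)).2
  · intro w hw
    simpa using hb _ (gen r hr2 w (by simpa using hw)).2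
end abs

section abs2
variable {A : Type*} [CStarAlgebra A] [Nontrivial A]

/-- Embedding of `ℂ` as the slice of `I`. -/
def iota (I : H) (hI : I * I = -1) : ℂ →ₐ[ℝ] H := Complex.lift ⟨I, hI⟩

lemma iota_apply (I : H) (hI : I * I = -1) (z : ℂ) : iota I hI z = (z.re : H) + z.im • I := by
  simp [iota]

lemma unit_sq (I : H) (h0 : I.re = 0) (h1 : ‖I‖ = 1) : I * I = -1 := by
  have h : I * star I = 1 := by
    rw [Quaternion.self_mul_star, Quaternion.normSq_eq_norm_mul_self, h1]; simp
  have : star I = -I := by ext <;> simp [h0]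
  rw [this, mul_neg] at h
  rw [← h, neg_neg]

lemma norm_iota (I : H) (h0 : I.re = 0) (h1 : ‖I‖ = 1) (hI : I * I = -1) (z : ℂ) : ‖iota I hI z‖ = ‖z‖ := by
  have h2 := Quaternion.normSq_eq_norm_mul_self I
  rw [h1, Quaternion.normSq_def', h0] at h2
  have h3 := Quaternion.normSq_eq_norm_mul_self (iota I hI z)
  rw [iota_apply, Quaternion.normSq_def'] at h3
  simp [h0] at h3
  have h4 : ‖z‖ ^ 2 = z.re * z.re + z.im * z.im := by rw [Complex.sq_norm, Complex.normSq_apply]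
  rw [iota_apply]
  refine (pow_left_inj₀ (norm_nonneg _) (norm_nonneg _) two_ne_zero).1 ?_
  rw [h4, sq, ← h3]
  linear_combination z.im ^ 2 * h2

lemma exists_slice (p : H) : ∃ (I : H) (_ : I.re = 0) (_ : ‖I‖ = 1) (hI : I * I = -1) (z : ℂ), p = iota I hI z := by
  by_cases h : p.im = 0
  · obtain ⟨I, h0, h1⟩ := exists_unit
    refine ⟨I, h0, h1, unit_sq I h0 h1, ⟨p.re, 0⟩, ?_⟩
    rw [iota_apply]
    conv_lhs => rw [← Quaternion.re_add_im p, h]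
    simp
  · have hn : ‖p.im‖ ≠ 0 := norm_ne_zero_iff.2 h
    have hI0 : (‖p.im‖⁻¹ • p.im).re = 0 := by simp
    have hI1 : ‖‖p.im‖⁻¹ • p.im‖ = 1 := by rw [norm_smul]; simp [hn]
    refine ⟨_, hI0, hI1, unit_sq _ hI0 hI1, ⟨p.re, ‖p.im‖⟩, ?_⟩
    rw [iota_apply, smul_smul, mul_inv_cancel₀ hn, one_smul]
    exact (Quaternion.re_add_im p).symm

lemma summable_coef (a : ℕ → H) (ha : SummableOn a) (s : ℝ) (h0 : 0 ≤ s) (h1 : s < 1) :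
    Summable fun m => s ^ m * ‖a m‖ := by
  have h := (ha (s : H) (by rwa [Quaternion.norm_coe, Real.norm_of_nonneg h0])).norm
  simpa [norm_mul, norm_pow, Quaternion.norm_coe, abs_of_nonneg h0] using h

/-- The complexified power series. -/
def cF (φ : H →+* A) (a : ℕ → H) (z : ℂ) : A := ∑' m, z ^ m • φ (a m)

lemma cF_diff {φ : H →+* A} (h : Emb φ) (a : ℕ → H) (ha : SummableOn a) :
    DifferentiableOn ℂ (cF φ a) (Metric.ball 0 1) := by
  intro z hz
  have hz' : ‖z‖ < 1 := by simpa using hz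
  set s := (1 + ‖z‖) / 2 with hs
  have hs0 : 0 ≤ s := by positivity
  have hs1 : s < 1 := by rw [hs]; linarith
  have hd : DifferentiableOn ℂ (cF φ a) (Metric.ball 0 s) := by
    refine Complex.differentiableOn_tsum_of_summable_norm (summable_coef a ha s hs0 hs1) ?_ Metric.isOpen_ball ?_
    · intro m
      exact Differentiable.differentiableOn (by fun_prop)
    · intro m w hw
      rw [norm_smul, norm_pow, h.norm_eq]
      have : ‖w‖ ≤ s := by simpa using (Metric.mem_ball.1 hw).le
      gcongr
  refine (hd.differentiableAt (Metric.isOpen_ball.mem_nhds ?_)).differentiableWithinAt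
  simp [hs]; linarith

lemma cF_split {φ : H →+* A} (h : Emb φ) (a : ℕ → H) (ha : SummableOn a) (z : ℂ) (hz : ‖z‖ < 1) :
    ∃ α β : H, cF φ a z = φ α + Complex.I • φ β ∧
      ∀ (I : H) (hI : I * I = -1), evalC a (iota I hI z) = α + I * β := by
  have hsum := summable_coef a ha ‖z‖ (norm_nonneg _) hz
  have hu : Summable fun m => (z ^ m).re • a m := by
    refine Summable.of_norm_bounded hsum fun m => ?_
    rw [norm_smul]
    gcongr
    simpa using Complex.abs_re_le_norm (z ^ m)
  have hv : Summable fun m => (z ^ m).im • a m := by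
    refine Summable.of_norm_bounded hsum fun m => ?_
    rw [norm_smul]
    gcongr
    simpa using Complex.abs_im_le_norm (z ^ m)
  have hc : Continuous φ := by
    refine AddMonoidHomClass.continuous_of_bound φ 1 fun x => ?_
    rw [h.norm_eq, one_mul]
  refine ⟨∑' m, (z ^ m).re • a m, ∑' m, (z ^ m).im • a m, ?_, fun I hI => ?_⟩
  · have h1 := (hu.hasSum.map φ hc).add ((hv.hasSum.map φ hc).const_smul Complex.I)
    rw [cF, ← h1.tsum_eq]
    congr 1
    ext m
    have hsm : ∀ (x : ℝ) (q : H), φ (x • q) = (x : ℂ) • φ q := by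
      intro x q
      rw [← Quaternion.coe_mul_eq_smul, map_mul, h.hr, Algebra.smul_def]
    simp only [Function.comp_apply, hsm]
    rw [smul_smul, ← add_smul, mul_comm, Complex.re_add_im]
  · have h1 := hu.hasSum.add (hv.hasSum.mul_left I)
    rw [evalC, ← h1.tsum_eq]
    congr 1
    ext1 m
    rw [← map_pow, iota_apply, add_mul, Quaternion.coe_mul_eq_smul, smul_mul_assoc, mul_smul_comm]

lemma abs_main {φ : H →+* A} (h : Emb φ) (hni : ∀ I : H, φ I ≠ algebraMap ℂ A (-Complex.I))
    (a : ℕ → H) (ha : SelfMap a)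
    (p : H) (hp : ‖p‖ < 1) (r : ℝ) (hr1 : -1 < r) (hr2 : r < 1) :
    ‖(1 - evalC a (r : H) * star (evalC a p))⁻¹ * (evalC a (r : H) - evalC a p)‖ ≤
      ‖(1 - (r : H) * p)⁻¹ * ((r : H) - p)‖ := by
  obtain ⟨I, h0, h1, hI, z, rfl⟩ := exists_slice p
  have hz : ‖z‖ < 1 := by rwa [norm_iota I h0 h1] at hp
  have hrn : ‖(r : H)‖ < 1 := by rw [Quaternion.norm_coe, Real.norm_eq_abs, abs_lt]; exact ⟨hr1, hr2⟩
  set b := evalC a (r : H) with hb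
  have hb1 : ‖b‖ < 1 := ha.2 _ hrn
  have hF1 : ∀ w : ℂ, ‖w‖ < 1 → ‖cF φ a w‖ ≤ 1 := by
    intro w hw
    obtain ⟨α, β, e, he⟩ := cF_split h a ha.1 w hw
    rw [e]
    refine h.contr α β fun J hJ0 hJ1 => ?_
    rw [← he J (unit_sq J hJ0 hJ1)]
    exact ha.2 _ (by rwa [norm_iota J hJ0 hJ1])
  have hFr : cF φ a r = φ b := by
    obtain ⟨α, β, e, he⟩ := cF_split h a ha.1 r (by simpa using hrn)
    have hι : ∀ (J : H) (hJ : J * J = -1), iota J hJ (r : ℂ) = (r : H) := by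
      intro J hJ; rw [iota_apply]; simp
    have e1 := he I hI
    have e2 := he (-I) (by rw [neg_mul_neg, hI])
    rw [hι, ← hb] at e1 e2
    have hI0 : I ≠ 0 := by rintro rfl; simp at h1
    have e3 : I * β = 0 := by
      have : I * β = -(I * β) := by
        have := e1.symm.trans e2
        rw [neg_mul] at this
        exact add_left_cancel this
      have h2 : (2 : ℝ) • (I * β) = 0 := by
        rw [two_smul]; nth_rewrite 1 [this]; exact neg_add_cancel _
      exact (smul_eq_zero.1 h2).resolve_left two_ne_zero
    have e4 : β = 0 := (mul_eq_zero.1 e3).resolve_left hI0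
    rw [e, e1, e4]; simp
  set G : ℂ → A := fun w => Ring.inverse (1 - cF φ a w * φ (star b)) * (cF φ a w - φ b) with hG
  have hGd : DifferentiableOn ℂ G (Metric.ball 0 1) := by
    have hd := cF_diff h a ha.1
    intro w hw
    have hw' : ‖w‖ < 1 := by simpa using hw
    have hda := hd w hw
    have hu := (h.mob _ (hF1 w hw') b hb1).1
    have hD : DifferentiableWithinAt ℂ (fun w => 1 - cF φ a w * φ (star b)) (Metric.ball 0 1) w :=
      (hda.mul_const _).const_sub 1
    have hinv : DifferentiableAt ℂ (Ring.inverse : A → A) (1 - cF φ a w * φ (star b)) := by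
      obtain ⟨u, hu⟩ := hu
      rw [← hu]
      exact differentiableAt_inverse u.isUnit
    exact (hinv.comp_differentiableWithinAt w hD).mul (hda.sub_const _)
  have hGz := schwarz_real G hGd (fun w hw => (h.mob _ (hF1 w hw) b hb1).2) r hr1 hr2
    (by simp [hG, hFr]) z hz
  -- right-hand side
  have hR : ‖(1 - (r : H) * iota I hI z)⁻¹ * ((r : H) - iota I hI z)‖ = ‖(1 - r * z)⁻¹ * (r - z)‖ := by
    have e1 : 1 - (r : H) * iota I hI z = iota I hI (1 - r * z) := by
      have : iota I hI (r : ℂ) = (r : H) := by rw [iota_apply]; simp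
      rw [map_sub, map_mul, map_one, this]
    have e2 : (r : H) - iota I hI z = iota I hI (r - z) := by
      have : iota I hI (r : ℂ) = (r : H) := by rw [iota_apply]; simp
      rw [map_sub, this]
    rw [e1, e2, norm_mul, norm_inv, norm_iota I h0 h1, norm_iota I h0 h1, norm_mul, norm_inv]
  rw [hR]
  refine le_trans ?_ hGz
  obtain ⟨α, β, e, he⟩ := cF_split h a ha.1 z hz
  set c := evalC a (iota I hI z) with hc
  have hce : c = α + I * β := he I hI
  set P : A := 1 - Complex.I • φ I with hP
  have hP0 : P ≠ 0 := by
    intro h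
    apply hni I
    rw [hP, sub_eq_zero] at h
    rw [Algebra.algebraMap_eq_smul_one, h, smul_smul]
    simp
  have hPI : P * φ I = Complex.I • P := by
    rw [hP, sub_mul, smul_mul_assoc, ← map_mul, hI, smul_sub, smul_smul, Complex.I_mul_I]
    simp [add_comm]
  have hPF : P * cF φ a z = P * φ c := by
    rw [e, hce, map_add, map_mul, mul_add, mul_add, ← mul_assoc, hPI, mul_smul_comm, smul_mul_assoc]
  have hkey : P * φ (c - b) = P * φ (1 - c * star b) * G z := by
    have hu := (h.mob _ (hF1 z hz) b hb1).1
    have e1 : P * φ (1 - c * star b) = P * (1 - cF φ a z * φ (star b)) := by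
      rw [map_sub, map_one, map_mul, mul_sub, mul_sub, ← mul_assoc, ← mul_assoc, hPF]
    rw [e1, hG]
    simp only
    rw [mul_assoc, ← mul_assoc _ (Ring.inverse _), Ring.mul_inverse_cancel _ hu, one_mul, mul_sub, hPF, map_sub, mul_sub]
  have hn : ‖P‖ * ‖c - b‖ ≤ ‖P‖ * (‖1 - c * star b‖ * ‖G z‖) := by
    rw [← h.norm_mul, hkey, ← mul_assoc ‖P‖, ← h.norm_mul]
    exact norm_mul_le _ _
  have hn2 := le_of_mul_le_mul_left hn (norm_pos_iff.2 hP0)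
  have e3 : ‖1 - b * star c‖ = ‖1 - c * star b‖ := by
    rw [← norm_star]; simp
  have hc1 : ‖c‖ < 1 := ha.2 _ hp
  have hpos : 0 < ‖1 - c * star b‖ := by
    have : ‖c * star b‖ < 1 := by
      rw [norm_mul, norm_star]; nlinarith [norm_nonneg c, norm_nonneg b]
    have h5 := norm_sub_norm_le (1 : H) (c * star b)
    rw [norm_one] at h5
    linarith
  rw [norm_mul, norm_inv, e3, norm_sub_rev b c, inv_mul_le_iff₀ hpos]
  exact hn2
end abs2

section mat
open scoped Matrix.Norms.L2Operator

/-- Quaternions as 2x2 complex matrices. -/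
def phi : H →+* Matrix (Fin 2) (Fin 2) ℂ where
  toFun q := !![⟨q.re, q.imI⟩, ⟨q.imJ, q.imK⟩; ⟨-q.imJ, q.imK⟩, ⟨q.re, -q.imI⟩]
  map_one' := by
    ext i j; fin_cases i <;> fin_cases j <;> simp [Complex.ext_iff] <;> exact ⟨rfl, rfl⟩
  map_zero' := by
    ext i j; fin_cases i <;> fin_cases j <;> simp [Complex.ext_iff] <;> exact ⟨rfl, rfl⟩
  map_add' p q := by
    ext i j; fin_cases i <;> fin_cases j <;> simp [Complex.ext_iff] <;> ring
  map_mul' p q := by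
    ext i j; fin_cases i <;> fin_cases j <;> simp [Complex.ext_iff, Matrix.mul_apply, Fin.sum_univ_two] <;> constructor <;> ring

lemma phi_apply (q : H) : phi q = !![⟨q.re, q.imI⟩, ⟨q.imJ, q.imK⟩; ⟨-q.imJ, q.imK⟩, ⟨q.re, -q.imI⟩] := rfl

lemma phi_emb : Emb phi where
  hs q := by
    ext i j; fin_cases i <;> fin_cases j <;> simp [phi_apply, Complex.ext_iff, Matrix.star_apply]
  hr x := by
    ext i j; fin_cases i <;> fin_cases j <;> simp [phi_apply, Complex.ext_iff, Matrix.algebraMap_matrix_apply]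

lemma phi_ne (I : H) : phi I ≠ algebraMap ℂ _ (-Complex.I) := by
  intro h
  have h0 := congrFun (congrFun h 0) 0
  have h1 := congrFun (congrFun h 1) 1
  simp [phi_apply, Complex.ext_iff, Matrix.algebraMap_matrix_apply] at h0 h1
  linarith [h0.2, h1.2]

end mat

/-- Schwarz–Pick contraction with one real node: for a slice regular self-map
`f` of `𝔹`, `p ∈ 𝔹` and real `r ∈ (−1,1)`, `ρ(f(p), f(r)) ≤ ρ(p, r)`. -/
theorem schwarzPick_real_node (a : ℕ → H) (ha : SelfMap a)
    (p : H) (hp : ‖p‖ < 1) (r : ℝ) (hr1 : -1 < r) (hr2 : r < 1) :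
    ‖(1 - evalC a (r : H) * star (evalC a p))⁻¹ * (evalC a (r : H) - evalC a p)‖ ≤
      ‖(1 - (r : H) * p)⁻¹ * ((r : H) - p)‖ := by
  open scoped Matrix.Norms.L2Operator in exact abs_main phi_emb phi_ne a ha p hp r hr1 hr2

end QPaper
end
end
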